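/- arXiv:1609.08477 — 4 statements merged into one kernel-verified Lean document; each statement's English description precedes it below -/
import Mathlib

section
/- There is an absolute constant C > 0 such that for every continuously differentiable compactly supported function f : ℝ → ℝ and every r ∈ ℝ: (i) |f(r)|² ≤ C (1+r²)^{-1/2} ∫_ℝ |f'(ρ)|² (ρ²+1) dρ, and (ii) |f(r)|² ≤ C (1+r²)^{-3/2} ∫_ℝ |f'(ρ)|² (ρ²+1)² dρ. -/
open Real Filter MeasureTheory

/-- Weighted Cauchy–Schwarz estimate on a half line. -/
theorem strauss_core (w g G : ℝ → ℝ) (hw : Continuous w) (hw0 : ∀ x, 0 < w x)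
    (hG : ∀ x, 0 ≤ x → HasDerivAt G (-(g x)) x) (hg : ∀ x, 0 ≤ x → 1 ≤ g x * w x)
    (hgc : ContinuousOn g (Set.Ici 0))
    (hG0 : ∀ x, 0 ≤ x → 0 < G x) (f : ℝ → ℝ) (hf : ContDiff ℝ 1 f) (hs : HasCompactSupport f)
    (r : ℝ) (hr : 0 ≤ r) : f r ^ 2 ≤ G r * ∫ x : ℝ, (deriv f x) ^ 2 * w x := by
  have hd : Continuous (deriv f) := hf.continuous_deriv le_rfl
  have hA : Continuous fun x => (deriv f x) ^ 2 * w x := (hd.pow 2).mul hw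
  have hAs : HasCompactSupport fun x => (deriv f x) ^ 2 * w x := by
    refine hs.deriv.mono ?_
    intro x hx
    simp only [Function.mem_support] at hx ⊢
    intro h
    exact hx (by simp [h])
  have hAi : Integrable fun x => (deriv f x) ^ 2 * w x := hA.integrable_of_hasCompactSupport hAs
  obtain ⟨R, hR, hfR⟩ : ∃ R, r ≤ R ∧ f R = 0 := by
    obtain ⟨M, hM⟩ := hs.isCompact.bddAbove
    refine ⟨max r (M + 1), le_max_left _ _, ?_⟩
    by_contra h
    have := hM (subset_tsupport f h)
    have := le_max_right r (M + 1)
    linarith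
  set A := ∫ x : ℝ, (deriv f x) ^ 2 * w x with hAdef
  have hle : ∫ x in r..R, (deriv f x) ^ 2 * w x ≤ A := by
    rw [intervalIntegral.integral_of_le hR]
    exact setIntegral_le_integral hAi
      (Eventually.of_forall fun x => mul_nonneg (sq_nonneg _) (hw0 x).le)
  have hsub : Set.uIcc r R ⊆ Set.Ici 0 := by
    rw [Set.uIcc_of_le hR]
    intro x hx
    exact hr.trans hx.1
  have hgi : IntervalIntegrable g volume r R := (hgc.mono hsub).intervalIntegrable
  have h1 : ∫ x in r..R, deriv f x = f R - f r :=
    intervalIntegral.integral_eq_sub_of_hasDerivAt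
      (fun x _ => (hf.differentiable (by simp) x).hasDerivAt) (hd.intervalIntegrable _ _)
  have h2 : ∫ x in r..R, -(g x) = G R - G r :=
    intervalIntegral.integral_eq_sub_of_hasDerivAt
      (fun x hx => hG x (hsub hx)) hgi.neg
  rw [intervalIntegral.integral_neg] at h2
  have key : ∀ t : ℝ, 0 ≤ A - 2 * t * f r + t ^ 2 * G r := by
    intro t
    have h3 : 0 ≤ ∫ x in r..R,
        ((deriv f x) ^ 2 * w x + (2 * t) * deriv f x + t ^ 2 * g x) := by
      refine intervalIntegral.integral_nonneg hR fun x hx => ?_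
      have hx0 : 0 ≤ x := hr.trans hx.1
      have := hg x hx0
      have hp := hw0 x
      refine nonneg_of_mul_nonneg_right (b := _) (a := w x) ?_ hp
      nlinarith [sq_nonneg (w x * deriv f x + t),
        mul_nonneg (sq_nonneg t) (sub_nonneg.2 this)]
    have i1 : IntervalIntegrable (fun x => (deriv f x) ^ 2 * w x) volume r R :=
      hA.intervalIntegrable _ _
    have i2 : IntervalIntegrable (fun x => (2 * t) * deriv f x) volume r R :=
      (continuous_const.mul hd).intervalIntegrable _ _
    rw [intervalIntegral.integral_add (i1.add i2) (hgi.const_mul _),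
      intervalIntegral.integral_add i1 i2, intervalIntegral.integral_const_mul,
      intervalIntegral.integral_const_mul, h1, hfR] at h3
    have h4 := hG0 R (hr.trans hR)
    have h5 : ∫ x in r..R, g x ≤ G r := by linarith
    nlinarith [mul_le_mul_of_nonneg_left h5 (sq_nonneg t)]
  have hGr := hG0 r hr
  have h6 := key (f r / G r)
  have h7 : A - 2 * (f r / G r) * f r + (f r / G r) ^ 2 * G r = A - f r ^ 2 / G r := by
    field_simp
    ring
  rw [h7, sub_nonneg, div_le_iff₀ hGr] at h6
  linarith

theorem strauss_pow (n : ℕ) (f : ℝ → ℝ) (hf : ContDiff ℝ 1 f) (hs : HasCompactSupport f)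
    (r : ℝ) (hr : 0 ≤ r) (hn : n = 1 ∨ n = 2) :
    f r ^ 2 ≤ 4 * ((1 + r) ^ (2 * n - 1))⁻¹ * ∫ x : ℝ, (deriv f x) ^ 2 * (x ^ 2 + 1) ^ n := by
  refine strauss_core (fun x => (x ^ 2 + 1) ^ n)
    (fun x => 4 * ((2 * n - 1 : ℕ) * (1 + x) ^ (2 * n - 1 - 1) / ((1 + x) ^ (2 * n - 1)) ^ 2))
    (fun x => 4 * ((1 + x) ^ (2 * n - 1))⁻¹)
    (by fun_prop) (fun x => by positivity) ?_ ?_ ?_ (fun x hx => by positivity) f hf hs r hr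
  · intro x hx
    have hne : (1 + x) ^ (2 * n - 1) ≠ 0 := by positivity
    have h0 : HasDerivAt (fun y : ℝ => (1 + y) ^ (2 * n - 1))
        ((2 * n - 1 : ℕ) * (1 + x) ^ (2 * n - 1 - 1)) x := by
      have h00 := ((hasDerivAt_id' x).const_add 1).fun_pow (2 * n - 1)
      rwa [mul_one] at h00
    have h := (h0.fun_inv hne).const_mul (4 : ℝ)
    rw [neg_div, mul_neg] at h
    exact h
  · intro x hx
    have h1 : (1 + x) ^ 2 ≤ 2 * (x ^ 2 + 1) := by nlinarith [sq_nonneg (x - 1)]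
    have h2 : ((1 + x) ^ 2) ^ 2 ≤ (2 * (x ^ 2 + 1)) ^ 2 := by gcongr
    have hp : 0 < 1 + x := by linarith
    rcases hn with rfl | rfl
    · norm_num
      field_simp
      nlinarith
    · norm_num
      field_simp
      nlinarith
  · refine ContinuousOn.mul continuousOn_const (ContinuousOn.div (by fun_prop) (by fun_prop) ?_)
    intro x hx
    have : (0 : ℝ) ≤ x := hx
    positivity

theorem strauss_pos (f : ℝ → ℝ) (hf : ContDiff ℝ 1 f) (hs : HasCompactSupport f)
    (r : ℝ) (hr : 0 ≤ r) :
      ((f r) ^ 2 ≤ 4 * (1 + r ^ 2) ^ (-(1 / 2 : ℝ)) *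
        ∫ ρ : ℝ, (deriv f ρ) ^ 2 * (ρ ^ 2 + 1)) ∧
      ((f r) ^ 2 ≤ 4 * (1 + r ^ 2) ^ (-(3 / 2 : ℝ)) *
        ∫ ρ : ℝ, (deriv f ρ) ^ 2 * (ρ ^ 2 + 1) ^ 2) := by
  have hle : 1 + r ^ 2 ≤ (1 + r) ^ 2 := by nlinarith
  have h0 : 0 < 1 + r ^ 2 := by positivity
  have hp : 0 ≤ 1 + r := by linarith
  have e (k : ℕ) : ((1 + r) ^ k)⁻¹ ≤ (1 + r ^ 2) ^ (-(k / 2 : ℝ)) := by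
    have := Real.rpow_le_rpow_of_nonpos h0 hle (z := -(k / 2 : ℝ))
      (by have : (0 : ℝ) ≤ k := k.cast_nonneg
          linarith)
    refine le_trans (le_of_eq ?_) this
    rw [← Real.rpow_natCast (1 + r) 2, ← Real.rpow_mul hp, ← Real.rpow_natCast (1 + r) k,
      ← Real.rpow_neg hp]
    congr 1
    push_cast
    ring
  have e1 := e 1
  have e3 := e 3
  norm_num at e1 e3
  constructor
  · have h := strauss_pow 1 f hf hs r hr (Or.inl rfl)
    norm_num at h ⊢
    refine h.trans ?_
    gcongr
  · have h := strauss_pow 2 f hf hs r hr (Or.inr rfl)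
    norm_num at h ⊢
    refine h.trans ?_
    gcongr

theorem stmt14 :
    ∃ C : ℝ, 0 < C ∧ ∀ f : ℝ → ℝ, ContDiff ℝ 1 f → HasCompactSupport f → ∀ r : ℝ,
      ((f r) ^ 2 ≤ C * (1 + r ^ 2) ^ (-(1 / 2 : ℝ)) *
        ∫ ρ : ℝ, (deriv f ρ) ^ 2 * (ρ ^ 2 + 1)) ∧
      ((f r) ^ 2 ≤ C * (1 + r ^ 2) ^ (-(3 / 2 : ℝ)) *
        ∫ ρ : ℝ, (deriv f ρ) ^ 2 * (ρ ^ 2 + 1) ^ 2) := by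
  refine ⟨4, by norm_num, fun f hf hs r => ?_⟩
  rcases le_total 0 r with hr | hr
  · exact strauss_pos f hf hs r hr
  · have h := strauss_pos (fun x => f (-x)) (hf.comp contDiff_neg)
      (hs.comp_homeomorph (Homeomorph.neg ℝ)) (-r) (by linarith)
    have i1 := integral_neg_eq_self (fun ρ : ℝ => (deriv f ρ) ^ 2 * (ρ ^ 2 + 1)) volume
    have i2 := integral_neg_eq_self (fun ρ : ℝ => (deriv f ρ) ^ 2 * (ρ ^ 2 + 1) ^ 2) volume
    simp only [neg_sq] at i1 i2
    simp only [deriv_comp_neg, neg_sq, neg_neg] at h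
    rw [i1, i2] at h
    exact h
end

section
/- There are absolute constants C > 0 and c > 0 such that for every smooth compactly supported function f : ℝ → ℝ: (i) ∫_ℝ |f(r)|² dr ≤ C ∫_ℝ |f'(r)|² (r²+1) dr; (ii) ∫_ℝ |f(r)|² (r²+1) dr ≤ C ∫_ℝ |f'(r)|² (r²+1)² dr; and (iii) setting u(r) = (r²+1)^{-1/2} f(r), one has c ∫_ℝ |f'(r)|² (r²+1) dr ≤ ∫_ℝ |u'(r)|² (r²+1)² dr ≤ C ∫_ℝ |f'(r)|² (r²+1) dr. -/
open Real Filter MeasureTheory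

theorem aux_int {K : Set ℝ} (hK : IsCompact K) {A B G Gd : ℝ → ℝ}
    (hA : Continuous A) (hB : Continuous B) (hG : Continuous G) (hGd : Continuous Gd)
    (hA0 : ∀ x, x ∉ K → A x = 0) (hB0 : ∀ x, x ∉ K → B x = 0)
    (hG0 : ∀ x, x ∉ K → G x = 0) (hGdz : ∀ x, x ∉ K → Gd x = 0)
    (hd : ∀ x, HasDerivAt G (Gd x) x) (h : ∀ x, A x ≤ B x + Gd x) :
    ∫ x, A x ≤ ∫ x, B x := by
  have iA : Integrable A := hA.integrable_of_hasCompactSupport (HasCompactSupport.intro hK hA0)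
  have iB : Integrable B := hB.integrable_of_hasCompactSupport (HasCompactSupport.intro hK hB0)
  have iG : Integrable G := hG.integrable_of_hasCompactSupport (HasCompactSupport.intro hK hG0)
  have iGd : Integrable Gd :=
    hGd.integrable_of_hasCompactSupport (HasCompactSupport.intro hK hGdz)
  have h0 : ∫ x, Gd x = 0 := integral_eq_zero_of_hasDerivAt_of_integrable hd iGd iG
  calc ∫ x, A x ≤ ∫ x, (B x + Gd x) := integral_mono iA (iB.add iGd) h
    _ = ∫ x, B x := by rw [integral_add iB iGd, h0, add_zero]

theorem stmt15 :
    ∃ C : ℝ, 0 < C ∧ ∃ c : ℝ, 0 < c ∧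
      ∀ f : ℝ → ℝ, ContDiff ℝ (⊤ : ℕ∞) f → HasCompactSupport f →
        ((∫ r : ℝ, (f r) ^ 2) ≤ C * ∫ r : ℝ, (deriv f r) ^ 2 * (r ^ 2 + 1)) ∧
        ((∫ r : ℝ, (f r) ^ 2 * (r ^ 2 + 1)) ≤
          C * ∫ r : ℝ, (deriv f r) ^ 2 * (r ^ 2 + 1) ^ 2) ∧
        ((c * ∫ r : ℝ, (deriv f r) ^ 2 * (r ^ 2 + 1)) ≤
            (∫ r : ℝ, (deriv (fun s => f s / Real.sqrt (s ^ 2 + 1)) r) ^ 2 * (r ^ 2 + 1) ^ 2) ∧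
          (∫ r : ℝ, (deriv (fun s => f s / Real.sqrt (s ^ 2 + 1)) r) ^ 2 * (r ^ 2 + 1) ^ 2) ≤
            C * ∫ r : ℝ, (deriv f r) ^ 2 * (r ^ 2 + 1)) := by
  refine ⟨9, by norm_num, 1, by norm_num, fun f hf hs => ?_⟩
  have cf : Continuous f := hf.continuous
  have cfd : Continuous (deriv f) := hf.continuous_deriv (by simp)
  have df : ∀ x, HasDerivAt f (deriv f x) x := fun x =>
    ((hf.differentiable (by simp)) x).hasDerivAt
  have hK : IsCompact (tsupport f) := hs
  have f0 : ∀ x, x ∉ tsupport f → f x = 0 := fun x hx => image_eq_zero_of_notMem_tsupport hx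
  have fdz : ∀ x, x ∉ tsupport f → deriv f x = 0 := fun x hx => by
    by_contra hne
    exact hx (support_deriv_subset hne)
  have hpos : ∀ r : ℝ, 0 < r ^ 2 + 1 := fun r => by positivity
  have hne : ∀ r : ℝ, r ^ 2 + 1 ≠ 0 := fun r => (hpos r).ne'
  have hu : (fun r : ℝ => (deriv (fun s => f s / Real.sqrt (s ^ 2 + 1)) r) ^ 2 * (r ^ 2 + 1) ^ 2)
      = fun r => (deriv f r - r * f r / (r ^ 2 + 1)) ^ 2 * (r ^ 2 + 1) := by
    funext r
    have hw : HasDerivAt (fun s : ℝ => Real.sqrt (s ^ 2 + 1))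
        ((2 * r) / (2 * Real.sqrt (r ^ 2 + 1))) r := by
      have h1 : HasDerivAt (fun s : ℝ => s ^ 2 + 1) (2 * r) r := by
        simpa using ((hasDerivAt_id r).pow 2).add_const 1
      exact h1.sqrt (hne r)
    have hwp : 0 < Real.sqrt (r ^ 2 + 1) := Real.sqrt_pos.2 (hpos r)
    have hd := ((df r).fun_div hw hwp.ne').deriv
    rw [hd]
    have hsq : Real.sqrt (r ^ 2 + 1) ^ 2 = r ^ 2 + 1 := Real.sq_sqrt (hpos r).le
    generalize Real.sqrt (r ^ 2 + 1) = w at *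
    rw [← hsq]
    field_simp
  rw [hu]
  have dG : ∀ x, HasDerivAt (fun r => r * f r ^ 2) (f x ^ 2 + 2 * x * f x * deriv f x) x := by
    intro x
    have := (hasDerivAt_id x).fun_mul ((df x).fun_pow 2)
    refine this.congr_deriv ?_
    simp; ring
  have dH : ∀ x, HasDerivAt (fun r => 2 * ((r + r ^ 3 / 3) * f r ^ 2))
      (2 * ((1 + x ^ 2) * f x ^ 2 + 2 * (x + x ^ 3 / 3) * f x * deriv f x)) x := by
    intro x
    have h1 : HasDerivAt (fun r : ℝ => r + r ^ 3 / 3) (1 + x ^ 2) x := by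
      refine ((hasDerivAt_id x).fun_add (((hasDerivAt_id x).fun_pow 3).div_const 3)).congr_deriv ?_
      simp
    refine ((h1.fun_mul ((df x).fun_pow 2)).const_mul 2).congr_deriv ?_
    simp; ring
  have cu : Continuous fun r => (deriv f r - r * f r / (r ^ 2 + 1)) ^ 2 * (r ^ 2 + 1) := by
    have : Continuous fun r => r * f r / (r ^ 2 + 1) :=
      Continuous.div (by fun_prop) (by fun_prop) hne
    fun_prop
  have key : ∀ r, (deriv f r - r * f r / (r ^ 2 + 1)) ^ 2 * (r ^ 2 + 1)
      = deriv f r ^ 2 * (r ^ 2 + 1) - 2 * r * f r * deriv f r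
        + f r ^ 2 * (r ^ 2 / (r ^ 2 + 1)) := by
    intro r
    have := hne r
    field_simp
    ring
  have hq : ∀ r : ℝ, r ^ 2 / (r ^ 2 + 1) ≤ 1 := fun r => by
    rw [div_le_one (hpos r)]; linarith
  have hq0 : ∀ r : ℝ, 0 ≤ r ^ 2 / (r ^ 2 + 1) := fun r => by positivity
  simp only [← integral_const_mul]
  refine ⟨?_, ?_, ?_, ?_⟩
  · refine aux_int hK (G := fun r => 2 * (r * f r ^ 2)) (by fun_prop) (by fun_prop) (by fun_prop) (?_) ?_ ?_ ?_ ?_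
      (fun x => (dG x).const_mul 2) ?_
    · fun_prop
    iterate 4 (intro x hx; simp [f0 x hx, fdz x hx])
    intro x
    nlinarith [sq_nonneg (f x + 2 * x * deriv f x), sq_nonneg (deriv f x), sq_nonneg (x * deriv f x)]
  · refine aux_int hK (G := fun r => 2 * ((r + r ^ 3 / 3) * f r ^ 2)) (by fun_prop) (by fun_prop) (by fun_prop) (?_) ?_ ?_ ?_ ?_
      dH ?_
    · fun_prop
    iterate 4 (intro x hx; simp [f0 x hx, fdz x hx])
    intro x

    have e : 0 ≤ (x ^ 2 + 1) * (f x + 2 * (x * (1 + x ^ 2 / 3) / (x ^ 2 + 1)) * deriv f x) ^ 2 := by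
      have := hpos x
      positivity
    have e2 : (x ^ 2 + 1) * (f x + 2 * (x * (1 + x ^ 2 / 3) / (x ^ 2 + 1)) * deriv f x) ^ 2
        = (x ^ 2 + 1) * f x ^ 2 + 4 * (x + x ^ 3 / 3) * f x * deriv f x
          + 4 * (x ^ 2 * (1 + x ^ 2 / 3) ^ 2 / (x ^ 2 + 1)) * deriv f x ^ 2 := by
      have := hne x
      field_simp
      ring
    have e3 : x ^ 2 * (1 + x ^ 2 / 3) ^ 2 / (x ^ 2 + 1) ≤ (x ^ 2 + 1) ^ 2 := by
      rw [div_le_iff₀ (hpos x)]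
      have : 0 ≤ x ^ 2 := sq_nonneg x
      generalize x ^ 2 = y at *
      have h2 : 0 ≤ y ^ 2 := by positivity
      have h3 : 0 ≤ y ^ 3 := by positivity
      nlinarith
    have e4 := mul_le_mul_of_nonneg_right e3 (sq_nonneg (deriv f x))
    have e5 : 0 ≤ deriv f x ^ 2 * (x ^ 2 + 1) ^ 2 := by positivity
    linarith
  · refine aux_int hK (G := fun r => r * f r ^ 2) (by fun_prop) cu (by fun_prop) (?_) ?_ ?_ ?_ ?_
      dG ?_
    · fun_prop
    iterate 4 (intro x hx; simp [f0 x hx, fdz x hx])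
    intro x
    rw [key]
    have := mul_nonneg (sq_nonneg (f x)) (hq0 x)
    nlinarith [sq_nonneg (f x)]
  · refine aux_int hK (G := fun r => 3 * (r * f r ^ 2)) cu (by fun_prop) (by fun_prop) (?_) ?_ ?_ ?_ ?_
      (fun x => (dG x).const_mul 3) ?_
    · fun_prop
    iterate 4 (intro x hx; simp [f0 x hx, fdz x hx])
    intro x
    rw [key]
    have := mul_le_mul_of_nonneg_left (hq x) (sq_nonneg (f x))
    nlinarith [sq_nonneg (f x + 2 * x * deriv f x), sq_nonneg (deriv f x), sq_nonneg (x * deriv f x)]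
end

section
/- Fix an integer n ≥ 0, let Q : ℝ → ℝ be a C² solution of the harmonic map ODE with lim_{r→-∞} Q(r) = 0 and lim_{r→+∞} Q(r) = nπ, and let V, N be as in the reduced wormhole wave equation. Let u : ℝ × ℝ → ℝ be a C² global solution of ∂_t²u − ∂_r²u − (4r/(r²+1)) ∂_r u + V(r) u = N(r, u) such that for every t the quantity ∫_ℝ (|∂_r u(t,r)|² + |∂_t u(t,r)|²)(r²+1)² dr is finite and such that the trajectory of u is totally bounded in the ℋ-norm. Then: (i) for every R ≥ 0, ∫_{|r| ≥ R + |t|} (|∂_r u(t,r)|² + |∂_t u(t,r)|²)(r²+1)² dr → 0 as |t| → ∞; and (ii) sup_{t ∈ ℝ} ∫_{|r| ≥ R + |t|} (|∂_r u(t,r)|² + |∂_t u(t,r)|²)(r²+1)² dr → 0 as R → ∞. -/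
open Real Filter MeasureTheory

/-- `F` is a (global, C²) solution of the harmonic map ODE
`F'' + (2r/(r²+1)) F' - sin(2F)/(r²+1) = 0` on the wormhole. -/
def IsHarmonicMapSol (F : ℝ → ℝ) : Prop :=
  ContDiff ℝ 2 F ∧
    ∀ r : ℝ, deriv (deriv F) r + (2 * r / (r ^ 2 + 1)) * deriv F r
      - Real.sin (2 * F r) / (r ^ 2 + 1) = 0

/-- The potential `V(r) = (r²+1)^{-2} + 2(r²+1)^{-1}(cos 2Q - 1)` of the reduced
wormhole wave equation. -/
noncomputable def Vpot (Q : ℝ → ℝ) (r : ℝ) : ℝ :=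
  1 / (r ^ 2 + 1) ^ 2 + 2 / (r ^ 2 + 1) * (Real.cos (2 * Q r) - 1)

/-- The nonlinearity `N(r,u)` of the reduced wormhole wave equation. -/
noncomputable def Npot (Q : ℝ → ℝ) (r v : ℝ) : ℝ :=
  2 * Real.sin (Real.sqrt (r ^ 2 + 1) * v) ^ 2 * Real.sin (2 * Q r)
      / Real.sqrt (r ^ 2 + 1) ^ 3
    + (2 * Real.sqrt (r ^ 2 + 1) * v - Real.sin (2 * Real.sqrt (r ^ 2 + 1) * v)) *
        Real.cos (2 * Q r) / Real.sqrt (r ^ 2 + 1) ^ 3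

/-- `u` is a global C² solution of the reduced wormhole wave equation
`∂_t²u − ∂_r²u − (4r/(r²+1)) ∂_r u + V u = N(r,u)`. -/
def SolvesReduced (Q : ℝ → ℝ) (u : ℝ → ℝ → ℝ) : Prop :=
  ContDiff ℝ 2 (fun p : ℝ × ℝ => u p.1 p.2) ∧
    ∀ t r : ℝ,
      deriv (deriv (fun s => u s r)) t - deriv (deriv (u t)) r
        - (4 * r / (r ^ 2 + 1)) * deriv (u t) r + Vpot Q r * u t r = Npot Q r (u t r)

/-- For every `t`, the solution `u` has finite energy in `ℋ = Ḣ¹ × L²((r²+1)² dr)`. -/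
def FiniteEnergyReduced (u : ℝ → ℝ → ℝ) : Prop :=
  ∀ t : ℝ, Integrable (fun r : ℝ =>
    ((deriv (u t) r) ^ 2 + (deriv (fun s => u s r) t) ^ 2) * (r ^ 2 + 1) ^ 2)

/-- The trajectory `{(u(t), ∂_t u(t)) : t ∈ ℝ}` is totally bounded in the ℋ-norm:
for every `ε > 0` there are finitely many times `t₁, …, t_N` such that every time slice
is within ℋ-distance `ε` of one of them. -/
def TotallyBoundedTraj (u : ℝ → ℝ → ℝ) : Prop :=
  ∀ ε : ℝ, 0 < ε → ∃ (N : ℕ) (ts : Fin N → ℝ), ∀ t : ℝ, ∃ i : Fin N,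
    Real.sqrt (∫ r : ℝ,
      ((deriv (u t) r - deriv (u (ts i)) r) ^ 2 +
        (deriv (fun s => u s r) t - deriv (fun s => u s r) (ts i)) ^ 2) * (r ^ 2 + 1) ^ 2) < ε

/-- Energy density. -/
noncomputable def edens (u : ℝ → ℝ → ℝ) (t r : ℝ) : ℝ :=
  ((deriv (u t) r) ^ 2 + (deriv (fun s => u s r) t) ^ 2) * (r ^ 2 + 1) ^ 2

/-- Energy density of a difference of two time slices. -/
noncomputable def ddens (u : ℝ → ℝ → ℝ) (t s r : ℝ) : ℝ :=
  ((deriv (u t) r - deriv (u s) r) ^ 2 +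
    (deriv (fun s => u s r) t - deriv (fun s => u s r) s) ^ 2) * (r ^ 2 + 1) ^ 2

lemma edens_nonneg (u : ℝ → ℝ → ℝ) (t r : ℝ) : 0 ≤ edens u t r := by
  unfold edens; positivity

lemma ddens_nonneg (u : ℝ → ℝ → ℝ) (t s r : ℝ) : 0 ≤ ddens u t s r := by
  unfold ddens; positivity

lemma edens_le (u : ℝ → ℝ → ℝ) (t s r : ℝ) :
    edens u t r ≤ 2 * ddens u t s r + 2 * edens u s r := by
  unfold edens ddens
  have h : ∀ a b c d w : ℝ, 0 ≤ w →
      (a ^ 2 + b ^ 2) * w ≤ 2 * (((a - c) ^ 2 + (b - d) ^ 2) * w) + 2 * ((c ^ 2 + d ^ 2) * w) := by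
    intro a b c d w hw
    nlinarith [mul_nonneg (sq_nonneg (a - 2 * c)) hw, mul_nonneg (sq_nonneg (b - 2 * d)) hw]
  exact h _ _ _ _ _ (by positivity)

lemma ddens_le (u : ℝ → ℝ → ℝ) (t s r : ℝ) :
    ddens u t s r ≤ 2 * edens u t r + 2 * edens u s r := by
  unfold edens ddens
  have h : ∀ a b c d w : ℝ, 0 ≤ w →
      ((a - c) ^ 2 + (b - d) ^ 2) * w ≤ 2 * ((a ^ 2 + b ^ 2) * w) + 2 * ((c ^ 2 + d ^ 2) * w) := by
    intro a b c d w hw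
    nlinarith [mul_nonneg (sq_nonneg (a + c)) hw, mul_nonneg (sq_nonneg (b + d)) hw]
  exact h _ _ _ _ _ (by positivity)

lemma ddens_cont (u : ℝ → ℝ → ℝ) (hu : ContDiff ℝ 2 (fun p : ℝ × ℝ => u p.1 p.2)) (t s : ℝ) :
    Continuous (ddens u t s) := by
  have h1 : ∀ t, Continuous (deriv (u t)) := by
    intro t
    have : ContDiff ℝ 2 (u t) := hu.comp (contDiff_const.prodMk contDiff_id)
    exact this.continuous_deriv (by norm_num)
  have h2 : ∀ t, Continuous (fun r => deriv (fun s => u s r) t) := by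
    intro t
    have he : (fun r => deriv (fun s => u s r) t)
        = fun r => fderiv ℝ (fun p : ℝ × ℝ => u p.1 p.2) (t, r) (1, 0) := by
      funext r
      have hd : HasFDerivAt (fun p : ℝ × ℝ => u p.1 p.2)
          (fderiv ℝ (fun p : ℝ × ℝ => u p.1 p.2) (t, r)) (t, r) :=
        (hu.differentiable (by norm_num) (t, r)).hasFDerivAt
      have hl : HasDerivAt (fun s : ℝ => (s, r)) ((1 : ℝ), (0 : ℝ)) t :=
        (hasDerivAt_id t).prodMk (hasDerivAt_const t r)
      exact (hd.comp_hasDerivAt t hl).deriv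
    rw [he]
    have hc := hu.continuous_fderiv (by norm_num)
    exact (hc.comp (by fun_prop : Continuous fun r : ℝ => (t, r))).clm_apply continuous_const
  have a := h1 t
  have b := h1 s
  have c := h2 t
  have d := h2 s
  unfold ddens
  fun_prop

lemma ddens_int (u : ℝ → ℝ → ℝ) (hu : ContDiff ℝ 2 (fun p : ℝ × ℝ => u p.1 p.2))
    (hf : ∀ t, Integrable (edens u t)) (t s : ℝ) : Integrable (ddens u t s) := by
  refine Integrable.mono' (((hf t).const_mul 2).add ((hf s).const_mul 2))
    (ddens_cont u hu t s).aestronglyMeasurable (Eventually.of_forall fun r => ?_)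
  rw [Real.norm_of_nonneg (ddens_nonneg u t s r)]
  exact ddens_le u t s r

lemma tail_meas (m : ℝ) : MeasurableSet {x : ℝ | m ≤ |x|} :=
  measurableSet_le measurable_const measurable_id.abs

lemma tail_tendsto (f : ℝ → ℝ) (hf : Integrable f) :
    Tendsto (fun m : ℕ => ∫ r in {x : ℝ | (m : ℝ) ≤ |x|}, f r) atTop (nhds 0) := by
  have h := tendsto_integral_of_dominated_convergence (μ := volume)
    (F := fun (m : ℕ) r => ({x : ℝ | (m : ℝ) ≤ |x|}).indicator f r) (f := fun _ => (0 : ℝ))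
    (fun r => ‖f r‖) (fun m => (hf.indicator (tail_meas m)).aestronglyMeasurable) hf.norm
    (fun m => Eventually.of_forall fun r => norm_indicator_le_norm_self _ _)
    (Eventually.of_forall fun r => by
      refine tendsto_const_nhds.congr' ?_
      obtain ⟨k, hk⟩ := exists_nat_gt |r|
      filter_upwards [eventually_ge_atTop k] with m hm
      rw [Set.indicator_of_notMem]
      simp only [Set.mem_ofPred_eq, not_le]
      exact hk.trans_le (by exact_mod_cast hm))
  simp only [integral_zero] at h
  refine h.congr fun m => ?_
  exact integral_indicator (tail_meas m)

lemma uniform_tail (u : ℝ → ℝ → ℝ) (hu : ContDiff ℝ 2 (fun p : ℝ × ℝ => u p.1 p.2))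
    (hf : ∀ t, Integrable (edens u t)) (hcomp : TotallyBoundedTraj u) (ε : ℝ) (hε : 0 < ε) :
    ∃ M : ℝ, ∀ m : ℝ, M ≤ m → ∀ t : ℝ, ∫ r in {x : ℝ | m ≤ |x|}, edens u t r < ε := by
  obtain ⟨N, ts, hts⟩ := hcomp (Real.sqrt (ε / 4)) (Real.sqrt_pos.2 (by positivity))
  have hev : ∀ᶠ k : ℕ in atTop, ∀ i : Fin N,
      ∫ r in {x : ℝ | (k : ℝ) ≤ |x|}, edens u (ts i) r < ε / 4 :=
    eventually_all.2 fun i => (tail_tendsto _ (hf (ts i))).eventually_lt_const (by positivity)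
  obtain ⟨k, hk⟩ := hev.exists
  refine ⟨k, fun m hm t => ?_⟩
  obtain ⟨i, hi⟩ := hts t
  have hd : ∫ r, ddens u t (ts i) r < ε / 4 := by
    have := (Real.sqrt_lt_sqrt_iff (integral_nonneg (ddens_nonneg u t (ts i)))).1 hi
    exact this
  have hdi := ddens_int u hu hf t (ts i)
  have hsub : ({x : ℝ | m ≤ |x|}) ⊆ {x : ℝ | (k : ℝ) ≤ |x|} := fun x hx => hm.trans hx
  calc ∫ r in {x : ℝ | m ≤ |x|}, edens u t r
      ≤ ∫ r in {x : ℝ | (k : ℝ) ≤ |x|}, edens u t r :=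
        setIntegral_mono_set (hf t).integrableOn
          (Eventually.of_forall (edens_nonneg u t)) hsub.eventuallyLE
    _ ≤ ∫ r in {x : ℝ | (k : ℝ) ≤ |x|}, (2 * ddens u t (ts i) r + 2 * edens u (ts i) r) :=
        setIntegral_mono (hf t).integrableOn
          ((hdi.const_mul 2).add ((hf (ts i)).const_mul 2)).integrableOn
          (edens_le u t (ts i))
    _ = 2 * (∫ r in {x : ℝ | (k : ℝ) ≤ |x|}, ddens u t (ts i) r)
        + 2 * ∫ r in {x : ℝ | (k : ℝ) ≤ |x|}, edens u (ts i) r := by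
        rw [integral_add (hdi.const_mul 2).integrableOn ((hf (ts i)).const_mul 2).integrableOn,
          integral_const_mul, integral_const_mul]
    _ < ε := by
        have h1 := setIntegral_le_integral (s := {x : ℝ | (k : ℝ) ≤ |x|}) hdi
          (Eventually.of_forall (ddens_nonneg u t (ts i)))
        have h2 := hk i
        linarith

theorem stmt16 (n : ℕ) (Q : ℝ → ℝ) (hQ : IsHarmonicMapSol Q)
    (hQb : Tendsto Q atBot (nhds 0))
    (hQt : Tendsto Q atTop (nhds ((n : ℝ) * Real.pi)))
    (u : ℝ → ℝ → ℝ) (hu : SolvesReduced Q u)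
    (hfin : FiniteEnergyReduced u) (hcomp : TotallyBoundedTraj u) :
    (∀ R : ℝ, 0 ≤ R → ∀ ε : ℝ, 0 < ε → ∃ T : ℝ, ∀ t : ℝ, T ≤ |t| →
      (∫ r in {x : ℝ | R + |t| ≤ |x|},
        ((deriv (u t) r) ^ 2 + (deriv (fun s => u s r) t) ^ 2) * (r ^ 2 + 1) ^ 2) < ε) ∧
    (∀ ε : ℝ, 0 < ε → ∃ R₀ : ℝ, ∀ R : ℝ, R₀ ≤ R → ∀ t : ℝ,
      (∫ r in {x : ℝ | R + |t| ≤ |x|},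
        ((deriv (u t) r) ^ 2 + (deriv (fun s => u s r) t) ^ 2) * (r ^ 2 + 1) ^ 2) < ε) := by
  refine ⟨fun R hR ε hε => ?_, fun ε hε => ?_⟩
  · obtain ⟨M, hM⟩ := uniform_tail u hu.1 hfin hcomp ε hε
    exact ⟨M, fun t ht => hM (R + |t|) (by linarith) t⟩
  · obtain ⟨M, hM⟩ := uniform_tail u hu.1 hfin hcomp ε hε
    exact ⟨M, fun R hR t => hM (R + |t|) (by linarith [abs_nonneg t]) t⟩
end

section
/- Fix an integer n ≥ 0, let Q : ℝ → ℝ be a C² solution of the harmonic map ODE with lim_{r→-∞} Q(r) = 0 and lim_{r→+∞} Q(r) = nπ, and let V, N be as in the reduced wormhole wave equation. Let u : ℝ × ℝ → ℝ be a C² global solution of ∂_t²u − ∂_r²u − (4r/(r²+1)) ∂_r u + V(r) u = N(r, u) such that for every t the quantity ∫_ℝ (|∂_r u(t,r)|² + |∂_t u(t,r)|²)(r²+1)² dr is finite and such that the trajectory of u is totally bounded in the ℋ-norm. Then there exists a C² function U : ℝ → ℝ with ∫_ℝ |U'(r)|²(r²+1)² dr < ∞ satisfying the static equation −U''(r) −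 (4r/(r²+1)) U'(r) + V(r) U(r) = N(r, U(r)) for all r ∈ ℝ, such that u(t,r) = U(r) and ∂_t u(t,r) = 0 for all t, r ∈ ℝ. -/
open Real Filter MeasureTheory

noncomputable def pD1 (F : ℝ → ℝ → ℝ) (t r : ℝ) : ℝ := deriv (fun s => F s r) t
noncomputable def pD2 (F : ℝ → ℝ → ℝ) (t r : ℝ) : ℝ := deriv (F t) r

def PC (n : WithTop ℕ∞) (F : ℝ → ℝ → ℝ) : Prop := ContDiff ℝ n (fun p : ℝ × ℝ => F p.1 p.2)

theorem pD1_hasDerivAt_fderiv {F : ℝ → ℝ → ℝ} (h : PC 1 F) (t r : ℝ) :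
    HasDerivAt (fun s => F s r) (fderiv ℝ (fun p : ℝ × ℝ => F p.1 p.2) (t, r) (1, 0)) t := by
  have h1 : HasFDerivAt (fun p : ℝ × ℝ => F p.1 p.2) _ (t, r) :=
    (h.differentiable (by norm_num) (t, r)).hasFDerivAt
  have h2 : HasDerivAt (fun s : ℝ => (s, r)) ((1 : ℝ), (0 : ℝ)) t :=
    (hasDerivAt_id t).prodMk (hasDerivAt_const t r)
  exact HasFDerivAt.comp_hasDerivAt t h1 h2

theorem pD2_hasDerivAt_fderiv {F : ℝ → ℝ → ℝ} (h : PC 1 F) (t r : ℝ) :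
    HasDerivAt (F t) (fderiv ℝ (fun p : ℝ × ℝ => F p.1 p.2) (t, r) (0, 1)) r := by
  have h1 : HasFDerivAt (fun p : ℝ × ℝ => F p.1 p.2) _ (t, r) :=
    (h.differentiable (by norm_num) (t, r)).hasFDerivAt
  have h2 : HasDerivAt (fun s : ℝ => (t, s)) ((0 : ℝ), (1 : ℝ)) r :=
    (hasDerivAt_const r t).prodMk (hasDerivAt_id r)
  exact HasFDerivAt.comp_hasDerivAt r h1 h2

theorem pD1_eq {F : ℝ → ℝ → ℝ} (h : PC 1 F) (t r : ℝ) :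
    pD1 F t r = fderiv ℝ (fun p : ℝ × ℝ => F p.1 p.2) (t, r) (1, 0) :=
  (pD1_hasDerivAt_fderiv h t r).deriv

theorem pD2_eq {F : ℝ → ℝ → ℝ} (h : PC 1 F) (t r : ℝ) :
    pD2 F t r = fderiv ℝ (fun p : ℝ × ℝ => F p.1 p.2) (t, r) (0, 1) :=
  (pD2_hasDerivAt_fderiv h t r).deriv

theorem pD1_hasDerivAt {F : ℝ → ℝ → ℝ} (h : PC 1 F) (t r : ℝ) :
    HasDerivAt (fun s => F s r) (pD1 F t r) t := by
  rw [pD1_eq h]; exact pD1_hasDerivAt_fderiv h t r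

theorem pD2_hasDerivAt {F : ℝ → ℝ → ℝ} (h : PC 1 F) (t r : ℝ) :
    HasDerivAt (F t) (pD2 F t r) r := by
  rw [pD2_eq h]; exact pD2_hasDerivAt_fderiv h t r

theorem PC.one {F : ℝ → ℝ → ℝ} (h : PC 2 F) : PC 1 F := ContDiff.of_le h (by norm_num)

theorem PC.cont {F : ℝ → ℝ → ℝ} (h : PC 1 F) : Continuous (fun p : ℝ × ℝ => F p.1 p.2) :=
  ContDiff.continuous h

theorem pD1_cont {F : ℝ → ℝ → ℝ} (h : PC 1 F) : Continuous (fun p : ℝ × ℝ => pD1 F p.1 p.2) := by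
  have : (fun p : ℝ × ℝ => pD1 F p.1 p.2)
      = fun p => fderiv ℝ (fun p : ℝ × ℝ => F p.1 p.2) p (1, 0) := by
    funext p; exact pD1_eq h p.1 p.2
  rw [this]
  exact (ContDiff.continuous_fderiv h (by norm_num)).clm_apply continuous_const

theorem pD2_cont {F : ℝ → ℝ → ℝ} (h : PC 1 F) : Continuous (fun p : ℝ × ℝ => pD2 F p.1 p.2) := by
  have : (fun p : ℝ × ℝ => pD2 F p.1 p.2)
      = fun p => fderiv ℝ (fun p : ℝ × ℝ => F p.1 p.2) p (0, 1) := by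
    funext p; exact pD2_eq h p.1 p.2
  rw [this]
  exact (ContDiff.continuous_fderiv h (by norm_num)).clm_apply continuous_const

theorem pD1_C {F : ℝ → ℝ → ℝ} (h : PC 2 F) : PC 1 (pD1 F) := by
  have : (fun p : ℝ × ℝ => pD1 F p.1 p.2)
      = fun p => fderiv ℝ (fun p : ℝ × ℝ => F p.1 p.2) p (1, 0) := by
    funext p; exact pD1_eq h.one p.1 p.2
  unfold PC
  rw [this]
  exact (ContDiff.fderiv_right h (m := 1) (by norm_num)).clm_apply contDiff_const

theorem pD2_C {F : ℝ → ℝ → ℝ} (h : PC 2 F) : PC 1 (pD2 F) := by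
  have : (fun p : ℝ × ℝ => pD2 F p.1 p.2)
      = fun p => fderiv ℝ (fun p : ℝ × ℝ => F p.1 p.2) p (0, 1) := by
    funext p; exact pD2_eq h.one p.1 p.2
  unfold PC
  rw [this]
  exact (ContDiff.fderiv_right h (m := 1) (by norm_num)).clm_apply contDiff_const

theorem pD_symm {F : ℝ → ℝ → ℝ} (h : PC 2 F) (t r : ℝ) :
    pD1 (pD2 F) t r = pD2 (pD1 F) t r := by
  have hs : IsSymmSndFDerivAt ℝ (fun p : ℝ × ℝ => F p.1 p.2) (t, r) :=
    ContDiffAt.isSymmSndFDerivAt (n := 2) (ContDiff.contDiffAt h) (by simp)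
  have hd : DifferentiableAt ℝ (fderiv ℝ (fun p : ℝ × ℝ => F p.1 p.2)) (t, r) :=
    (ContDiff.fderiv_right h (m := 1) (by norm_num)).differentiable (by norm_num) _
  rw [pD1_eq (pD2_C h), pD2_eq (pD1_C h)]
  have e1 : (fun p : ℝ × ℝ => pD1 F p.1 p.2)
      = fun p => fderiv ℝ (fun p : ℝ × ℝ => F p.1 p.2) p (1, 0) := by
    funext p; exact pD1_eq h.one p.1 p.2
  have e2 : (fun p : ℝ × ℝ => pD2 F p.1 p.2)
      = fun p => fderiv ℝ (fun p : ℝ × ℝ => F p.1 p.2) p (0, 1) := by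
    funext p; exact pD2_eq h.one p.1 p.2
  rw [e1, e2]
  rw [fderiv_clm_apply hd (by fun_prop), fderiv_clm_apply hd (by fun_prop)]
  simpa using hs.eq (1, 0) (0, 1)

theorem diag_hasDerivAt {F : ℝ → ℝ → ℝ} (h : PC 1 F) (a b c d T : ℝ) :
    HasDerivAt (fun T => F (a + c * T) (b + d * T))
      (c * pD1 F (a + c * T) (b + d * T) + d * pD2 F (a + c * T) (b + d * T)) T := by
  have h1 : HasFDerivAt (fun p : ℝ × ℝ => F p.1 p.2) _ (a + c * T, b + d * T) :=
    (h.differentiable (by norm_num) (a + c * T, b + d * T)).hasFDerivAt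
  have ha : HasDerivAt (fun s : ℝ => a + c * s) c T := by
    simpa using ((hasDerivAt_id T).const_mul c).const_add a
  have hb : HasDerivAt (fun s : ℝ => b + d * s) d T := by
    simpa using ((hasDerivAt_id T).const_mul d).const_add b
  have h3 := HasFDerivAt.comp_hasDerivAt T h1 (ha.prodMk hb)
  refine h3.congr_deriv ?_
  rw [pD1_eq h, pD2_eq h]
  have : ((c, d) : ℝ × ℝ) = c • ((1 : ℝ), (0 : ℝ)) + d • ((0 : ℝ), (1 : ℝ)) := by
    ext <;> simp
  rw [this, map_add, map_smul, map_smul]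
  simp

/-- differentiation under the integral sign, with joint continuity of the derivative -/
theorem hasDerivAt_param {K K' : ℝ → ℝ → ℝ} (a b t : ℝ)
    (hK : Continuous (fun p : ℝ × ℝ => K p.1 p.2))
    (hK' : Continuous (fun p : ℝ × ℝ => K' p.1 p.2))
    (hd : ∀ t s, HasDerivAt (fun x => K x s) (K' t s) t) :
    HasDerivAt (fun x => ∫ s in a..b, K x s) (∫ s in a..b, K' t s) t := by
  obtain ⟨C, hC⟩ := ((isCompact_Icc (a := t - 1) (b := t + 1)).prod
    (isCompact_uIcc (a := a) (b := b))).exists_bound_of_continuousOn hK'.continuousOn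
  have hc : ∀ {G : ℝ → ℝ → ℝ} (_ : Continuous (fun p : ℝ × ℝ => G p.1 p.2)) (x : ℝ),
      Continuous (G x) := fun {G} hG x => hG.comp (Continuous.prodMk_right x)
  refine (intervalIntegral.hasDerivAt_integral_of_dominated_loc_of_deriv_le
    (s := Set.Icc (t - 1) (t + 1)) (bound := fun _ => C)
    (Icc_mem_nhds (by linarith) (by linarith)) ?_ ?_ ?_ ?_ ?_ ?_).2
  · exact Eventually.of_forall fun x => (hc hK x).aestronglyMeasurable
  · exact (hc hK t).intervalIntegrable _ _
  · exact (hc hK' t).aestronglyMeasurable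
  · refine Eventually.of_forall fun s hs x hx => hC (x, s) ⟨hx, ?_⟩
    exact Set.uIoc_subset_uIcc hs
  · exact intervalIntegrable_const
  · exact Eventually.of_forall fun s _ x _ => hd x s

theorem leibniz {F : ℝ → ℝ → ℝ} (h : PC 1 F) (t s T : ℝ) :
    HasDerivAt (fun T => ∫ σ in (-T)..T, F (t + σ) (s + T))
      (F (t + T) (s + T) + F (t - T) (s + T) + ∫ σ in (-T)..T, pD2 F (t + σ) (s + T)) T := by
  have hsub : ∀ (G : ℝ → ℝ → ℝ) (T : ℝ), ∫ σ in (-T)..T, G (t + σ) (s + T)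
      = ∫ x in (-1:ℝ)..1, T * G (t + x * T) (s + T) := by
    intro G T
    have := intervalIntegral.mul_integral_comp_mul_left (a := -1) (b := 1)
      (f := fun σ => G (t + σ) (s + T)) T
    rw [intervalIntegral.integral_const_mul]
    simp only [mul_neg, mul_one] at this
    rw [← this]
    simp only [mul_comm]
  have c0 := h.cont
  have c1 := pD1_cont h
  have c2 := pD2_cont h
  have key : HasDerivAt (fun T => ∫ x in (-1:ℝ)..1, T * F (t + x * T) (s + T))
      (∫ x in (-1:ℝ)..1, (F (t + x * T) (s + T) +
        T * (x * pD1 F (t + x * T) (s + T) + pD2 F (t + x * T) (s + T)))) T := by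
    refine hasDerivAt_param (K := fun T x => T * F (t + x * T) (s + T))
      (K' := fun T x => F (t + x * T) (s + T) +
        T * (x * pD1 F (t + x * T) (s + T) + pD2 F (t + x * T) (s + T))) _ _ _ ?_ ?_ ?_
    · exact continuous_fst.mul (c0.comp (g := fun p : ℝ × ℝ => F p.1 p.2)
        (f := fun p : ℝ × ℝ => (t + p.2 * p.1, s + p.1)) (by fun_prop))
    · have e0 := (c0.comp (g := fun p : ℝ × ℝ => F p.1 p.2)
        (f := fun p : ℝ × ℝ => (t + p.2 * p.1, s + p.1)) (by fun_prop))
      have e1 := (c1.comp (g := fun p : ℝ × ℝ => pD1 F p.1 p.2)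
        (f := fun p : ℝ × ℝ => (t + p.2 * p.1, s + p.1)) (by fun_prop))
      have e2 := (c2.comp (g := fun p : ℝ × ℝ => pD2 F p.1 p.2)
        (f := fun p : ℝ × ℝ => (t + p.2 * p.1, s + p.1)) (by fun_prop))
      exact e0.add (continuous_fst.mul ((continuous_snd.mul e1).add e2))
    · intro T x
      have h2 := diag_hasDerivAt h t s x 1 T
      simp only [one_mul] at h2
      refine ((hasDerivAt_id T).mul h2).congr_deriv ?_
      simp
  have hint : ∫ x in (-1:ℝ)..1, (F (t + x * T) (s + T) +
        T * (x * pD1 F (t + x * T) (s + T) + pD2 F (t + x * T) (s + T)))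
      = F (t + T) (s + T) + F (t - T) (s + T) + ∫ x in (-1:ℝ)..1, T * pD2 F (t + x * T) (s + T) := by
    have d0 : Continuous (fun x => F (t + x * T) (s + T)) := c0.comp (g := fun p : ℝ × ℝ => F p.1 p.2)
        (f := fun x : ℝ => (t + x * T, s + T)) (by fun_prop)
    have d1 : Continuous (fun x => pD1 F (t + x * T) (s + T)) :=
      c1.comp (g := fun p : ℝ × ℝ => pD1 F p.1 p.2)
        (f := fun x : ℝ => (t + x * T, s + T)) (by fun_prop)
    have d2 : Continuous (fun x => pD2 F (t + x * T) (s + T)) :=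
      c2.comp (g := fun p : ℝ × ℝ => pD2 F p.1 p.2)
        (f := fun x : ℝ => (t + x * T, s + T)) (by fun_prop)
    have ftc : ∫ x in (-1:ℝ)..1, (F (t + x * T) (s + T) + T * (x * pD1 F (t + x * T) (s + T)))
        = 1 * F (t + 1 * T) (s + T) - (-1) * F (t + (-1) * T) (s + T) := by
      refine intervalIntegral.integral_eq_sub_of_hasDerivAt
        (f := fun x => x * F (t + x * T) (s + T)) ?_ ?_
      · intro x _
        have hlin : HasDerivAt (fun x : ℝ => t + x * T) T x := by
          simpa using ((hasDerivAt_id x).mul_const T).const_add t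
        have h2 : HasDerivAt (fun x => F (t + x * T) (s + T)) (pD1 F (t + x * T) (s + T) * T) x :=
          HasDerivAt.comp (h₂ := fun y => F y (s + T)) x (pD1_hasDerivAt h (t + x * T) (s + T)) hlin
        refine ((hasDerivAt_id x).mul h2).congr_deriv ?_
        simp only [id_eq]; ring
      · exact Continuous.intervalIntegrable (by fun_prop) _ _
    have e : ∀ x, F (t + x * T) (s + T) +
        T * (x * pD1 F (t + x * T) (s + T) + pD2 F (t + x * T) (s + T))
        = (F (t + x * T) (s + T) + T * (x * pD1 F (t + x * T) (s + T)))
          + T * pD2 F (t + x * T) (s + T) := fun x => by ring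
    simp only [e]
    rw [intervalIntegral.integral_add (Continuous.intervalIntegrable (by fun_prop) _ _)
      (Continuous.intervalIntegrable (by fun_prop) _ _), ftc]
    ring_nf
  rw [hint] at key
  simp only [hsub F]
  rw [hsub (pD2 F)]
  exact key

theorem diagP {F : ℝ → ℝ → ℝ} (h : PC 1 F) (t s T : ℝ) :
    HasDerivAt (fun T => F (t + T) (s + T)) (pD1 F (t + T) (s + T) + pD2 F (t + T) (s + T)) T := by
  have := diag_hasDerivAt h t s 1 1 T
  simpa only [one_mul] using this

theorem diagM {F : ℝ → ℝ → ℝ} (h : PC 1 F) (t s T : ℝ) :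
    HasDerivAt (fun T => F (t - T) (s + T)) (-pD1 F (t - T) (s + T) + pD2 F (t - T) (s + T)) T := by
  have := diag_hasDerivAt h t s (-1) 1 T
  simpa only [one_mul, neg_mul, ← sub_eq_add_neg] using this

/-- forcing term with respect to the free operator `∂_t² - ∂_r² + 2/r²` -/
noncomputable def forc (W : ℝ → ℝ → ℝ) (t r : ℝ) : ℝ :=
  pD2 (pD2 W) t r - pD1 (pD1 W) t r - 2 * W t r / r ^ 2

noncomputable def Efun (W : ℝ → ℝ → ℝ) (t s T : ℝ) : ℝ :=
  (pD2 W (t - T) (s + T) + W (t - T) (s + T) / (s + T) + pD1 W (t - T) (s + T))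
  + (pD2 W (t + T) (s + T) + W (t + T) (s + T) / (s + T) - pD1 W (t + T) (s + T))
  - (∫ σ in (-T)..T, pD2 W (t + σ) (s + T)) / (s + T)
  - (∫ σ in (-T)..T, W (t + σ) (s + T)) / (s + T) ^ 2

theorem cont_slice {F : ℝ → ℝ → ℝ} (h : Continuous (fun p : ℝ × ℝ => F p.1 p.2)) (t x : ℝ) :
    Continuous (fun σ => F (t + σ) x) :=
  h.comp (g := fun p : ℝ × ℝ => F p.1 p.2) (f := fun σ : ℝ => (t + σ, x)) (by fun_prop)

theorem forc_slice_int {W : ℝ → ℝ → ℝ} (h : PC 2 W) (t x T : ℝ) :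
    ∫ σ in (-T)..T, forc W (t + σ) x
      = (∫ σ in (-T)..T, pD2 (pD2 W) (t + σ) x) - (pD1 W (t + T) x - pD1 W (t - T) x)
        - 2 / x ^ 2 * ∫ σ in (-T)..T, W (t + σ) x := by
  have c1 := cont_slice (pD2_cont (pD2_C h)) t x
  have c2 := cont_slice (pD1_cont (pD1_C h)) t x
  have c3 := cont_slice h.one.cont t x
  have e : ∀ σ, forc W (t + σ) x = pD2 (pD2 W) (t + σ) x - pD1 (pD1 W) (t + σ) x
      - 2 / x ^ 2 * W (t + σ) x := fun σ => by unfold forc; ring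
  simp only [e]
  have c12 : Continuous (fun σ => pD2 (pD2 W) (t + σ) x - pD1 (pD1 W) (t + σ) x) := c1.sub c2
  have c3' : Continuous (fun σ => 2 / x ^ 2 * W (t + σ) x) := continuous_const.mul c3
  rw [intervalIntegral.integral_sub (c12.intervalIntegrable _ _)
      (c3'.intervalIntegrable _ _),
    intervalIntegral.integral_sub (c1.intervalIntegrable _ _)
      (c2.intervalIntegrable _ _), intervalIntegral.integral_const_mul]
  have : ∫ σ in (-T)..T, pD1 (pD1 W) (t + σ) x = pD1 W (t + T) x - pD1 W (t + (-T)) x := by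
    refine intervalIntegral.integral_eq_sub_of_hasDerivAt (f := fun σ => pD1 W (t + σ) x) ?_
      (c2.intervalIntegrable _ _)
    intro σ _
    have := pD1_hasDerivAt (pD1_C h) (t + σ) x
    exact HasDerivAt.comp_const_add t σ this
  rw [this]
  simp only [← sub_eq_add_neg]

theorem Efun_hasDerivAt {W : ℝ → ℝ → ℝ} (h : PC 2 W) (t s T : ℝ) (hs : s + T ≠ 0) :
    HasDerivAt (Efun W t s) (forc W (t - T) (s + T) + forc W (t + T) (s + T)
      - (∫ σ in (-T)..T, forc W (t + σ) (s + T)) / (s + T)) T := by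
  have hl : HasDerivAt (fun T : ℝ => s + T) 1 T := by simpa using (hasDerivAt_id T).const_add s
  have a1 := diagM (pD2_C h) t s T
  have a2 := (diagM h.one t s T).div hl hs
  have a3 := diagM (pD1_C h) t s T
  have b1 := diagP (pD2_C h) t s T
  have b2 := (diagP h.one t s T).div hl hs
  have b3 := diagP (pD1_C h) t s T
  have c1 := (leibniz (pD2_C h) t s T).div hl hs
  have c2 := (leibniz h.one t s T).div (hl.pow 2) (pow_ne_zero 2 hs)
  have := ((((a1.add a2).add a3).add ((b1.add b2).sub b3)).sub c1).sub c2
  refine this.congr_deriv ?_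
  rw [forc_slice_int h]
  simp only [pD_symm h, forc, Pi.pow_apply]
  field_simp
  ring

/-- If `|forc| ≤ g` beyond `R` and `G` is an antiderivative of `-g`, then `Efun` moves by at most `4 G`. -/
theorem Efun_bound {W : ℝ → ℝ → ℝ} (h : PC 2 W) {g G : ℝ → ℝ} {R : ℝ} (hR : 0 < R)
    (hf : ∀ t r, R ≤ r → |forc W t r| ≤ g r)
    (hG : ∀ r, R ≤ r → HasDerivAt G (-g r) r) (hG0 : ∀ r, R ≤ r → 0 ≤ G r)
    (t s T : ℝ) (hs : R ≤ s) (hT : 0 ≤ T) :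
    |2 * (pD2 W t s + W t s / s)| ≤ |Efun W t s T| + 4 * G s := by
  have h0 : Efun W t s 0 = 2 * (pD2 W t s + W t s / s) := by
    simp [Efun]; ring
  have key : |Efun W t s T - Efun W t s 0| ≤ 4 * (G s - G (s + T)) := by
    have hB : ∀ x, 0 ≤ x → HasDerivAt (fun x => 4 * (G s - G (s + x))) (4 * g (s + x)) x := by
      intro x hx
      have := ((HasDerivAt.comp_const_add s x (hG (s + x) (by linarith))).const_sub (G s)).const_mul 4
      simpa using this
    have := image_norm_le_of_norm_deriv_right_le_deriv_boundary' (a := 0) (b := T)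
      (f := fun x => Efun W t s x - Efun W t s 0)
      (f' := fun x => forc W (t - x) (s + x) + forc W (t + x) (s + x)
      - (∫ σ in (-x)..x, forc W (t + σ) (s + x)) / (s + x))
      (B := fun x => 4 * (G s - G (s + x))) (B' := fun x => 4 * g (s + x)) ?_ ?_ ?_ ?_ ?_ ?_
      (x := T) ⟨hT, le_refl T⟩
    · simpa using this
    · intro x hx
      exact ((Efun_hasDerivAt h t s x (by linarith [hx.1])).sub_const _).continuousAt.continuousWithinAt
    · intro x hx
      exact ((Efun_hasDerivAt h t s x (by linarith [hx.1])).sub_const _).hasDerivWithinAt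
    · simp
    · intro x hx
      exact (hB x hx.1).continuousAt.continuousWithinAt
    · intro x hx
      exact (hB x hx.1).hasDerivWithinAt
    · intro x hx
      have hx0 := hx.1
      have hsx : 0 < s + x := by linarith
      have e1 := hf (t - x) (s + x) (by linarith)
      have e2 := hf (t + x) (s + x) (by linarith)
      have e3 : |∫ σ in (-x)..x, forc W (t + σ) (s + x)| ≤ g (s + x) * |x - (-x)| := by
        refine intervalIntegral.norm_integral_le_of_norm_le_const (f := fun σ => forc W (t + σ) (s + x)) ?_
        intro σ _
        exact hf _ _ (by linarith)
      have hx2 : |x - (-x)| = 2 * x := by rw [abs_of_nonneg] <;> linarith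
      rw [hx2] at e3
      have e4 : |(∫ σ in (-x)..x, forc W (t + σ) (s + x)) / (s + x)| ≤ 2 * g (s + x) := by
        rw [abs_div, abs_of_pos hsx, div_le_iff₀ hsx]
        have : 0 ≤ g (s + x) := le_trans (abs_nonneg _) e1
        nlinarith
      rw [Real.norm_eq_abs]
      rw [abs_le] at e1 e2 e4 ⊢
      constructor <;> linarith [e1.1, e1.2, e2.1, e2.2, e4.1, e4.2]
  rw [← h0]
  have := hG0 (s + T) (by linarith)
  have := abs_sub_abs_le_abs_sub (Efun W t s 0) (Efun W t s T)
  rw [abs_sub_comm] at this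
  linarith

theorem lateral_estimate {W : ℝ → ℝ → ℝ} (h : PC 2 W) {g G K : ℝ → ℝ} {R : ℝ} (hR : 0 < R)
    (hf : ∀ t r, R ≤ r → |forc W t r| ≤ g r)
    (hG : ∀ r, R ≤ r → HasDerivAt G (-g r) r) (hG0 : ∀ r, R ≤ r → 0 ≤ G r)
    (hK : ∀ r, R ≤ r → HasDerivAt K (2 * r * G r) r)
    (htail : ∀ ε, 0 < ε → ∀ r1 r2, R ≤ r1 → r1 ≤ r2 → ∃ T, 1 ≤ T ∧
      (∀ t, ∫ x in r1..r2, (|pD2 W t (x + T)| + |pD1 W t (x + T)|) ≤ ε) ∧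
      ∀ t x, T ≤ x → |W t x| / x ≤ ε)
    (t r1 r2 : ℝ) (h1 : R ≤ r1) (h2 : r1 ≤ r2) :
    |r2 * W t r2 - r1 * W t r1| ≤ K r2 - K r1 := by
  have hr1 : 0 < r1 := by linarith
  have hr2 : 0 < r2 := by linarith
  have hFTC : r2 * W t r2 - r1 * W t r1 = ∫ x in r1..r2, (W t x + x * pD2 W t x) := by
    have cc1 : Continuous (fun x => W t x) := h.one.cont.comp (Continuous.prodMk_right t)
    have cc2 : Continuous (fun x => pD2 W t x) := (pD2_cont h.one).comp (Continuous.prodMk_right t)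
    rw [intervalIntegral.integral_eq_sub_of_hasDerivAt (f := fun x => x * W t x)]
    · intro x _
      refine ((hasDerivAt_id x).mul (pD2_hasDerivAt h.one t x)).congr_deriv ?_
      simp
    · exact Continuous.intervalIntegrable (by fun_prop) _ _
  have hKint : ∫ x in r1..r2, 2 * x * G x = K r2 - K r1 := by
    refine intervalIntegral.integral_eq_sub_of_hasDerivAt ?_ ?_
    · intro x hx
      rw [Set.uIcc_of_le h2] at hx
      exact hK x (by linarith [hx.1])
    · refine ContinuousOn.intervalIntegrable ?_
      intro x hx
      rw [Set.uIcc_of_le h2] at hx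
      have := (hG x (by linarith [hx.1])).continuousAt.continuousWithinAt (s := Set.uIcc r1 r2)
      exact (continuousWithinAt_const.mul continuousWithinAt_id).mul this
  have hKii : IntervalIntegrable (fun x => 2 * x * G x) volume r1 r2 := by
    refine ContinuousOn.intervalIntegrable ?_
    intro x hx
    rw [Set.uIcc_of_le h2] at hx
    have := (hG x (by linarith [hx.1])).continuousAt.continuousWithinAt (s := Set.uIcc r1 r2)
    exact (continuousWithinAt_const.mul continuousWithinAt_id).mul this
  have main : ∀ ε, 0 < ε → |r2 * W t r2 - r1 * W t r1|
      ≤ K r2 - K r1 + (r2 / 2 * (4 + 4 * (r2 - r1))) * ε := by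
    intro ε hε
    obtain ⟨T, hT1, hT2, hT3⟩ := htail ε hε r1 r2 h1 h2
    set K1 : ℝ → ℝ → ℝ := fun t x => |pD2 W t x| + |pD1 W t x| with hK1
    have hK1c : Continuous (fun p : ℝ × ℝ => K1 p.1 p.2) :=
      (pD2_cont h.one).abs.add (pD1_cont h.one).abs
    have hsl : ∀ t', Continuous (fun x => K1 t' (x + T)) := fun t' =>
      hK1c.comp (g := fun p : ℝ × ℝ => K1 p.1 p.2) (f := fun x : ℝ => (t', x + T)) (by fun_prop)
    have hK1c2 : Continuous (fun p : ℝ × ℝ => K1 (t + p.2) (p.1 + T)) :=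
      hK1c.comp (g := fun p : ℝ × ℝ => K1 p.1 p.2)
        (f := fun p : ℝ × ℝ => (t + p.2, p.1 + T)) (by fun_prop)
    have hIc : Continuous (fun x => ∫ σ in (-T)..T, K1 (t + σ) (x + T)) :=
      intervalIntegral.continuous_parametric_intervalIntegral_of_continuous'
        (f := fun x σ => K1 (t + σ) (x + T)) hK1c2 _ _
    have hW : ∀ t' x, T ≤ x → |W t' x / x| ≤ ε := by
      intro t' x hx
      rw [abs_div, abs_of_pos (show 0 < x by linarith)]
      exact hT3 t' x hx
    have hEb : ∀ x, r1 ≤ x → |Efun W t x T| ≤ K1 (t - T) (x + T) + K1 (t + T) (x + T) + 4 * ε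
        + (1 / T) * ∫ σ in (-T)..T, K1 (t + σ) (x + T) := by
      intro x hx
      have hxT : 0 < x + T := by linarith
      have w1 := hW (t - T) (x + T) (by linarith)
      have w2 := hW (t + T) (x + T) (by linarith)
      have i1 : |(∫ σ in (-T)..T, pD2 W (t + σ) (x + T)) / (x + T)|
          ≤ (1 / T) * ∫ σ in (-T)..T, K1 (t + σ) (x + T) := by
        have hle : |∫ σ in (-T)..T, pD2 W (t + σ) (x + T)| ≤ ∫ σ in (-T)..T, K1 (t + σ) (x + T) := by
          refine (intervalIntegral.abs_integral_le_integral_abs (by linarith)).trans ?_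
          refine intervalIntegral.integral_mono_on (by linarith) ?_ ?_ ?_
          · exact (cont_slice (pD2_cont h.one) t (x + T)).abs.intervalIntegrable _ _
          · exact (cont_slice hK1c t (x + T)).intervalIntegrable _ _
          · intro σ _
            simp only [hK1]
            linarith [abs_nonneg (pD1 W (t + σ) (x + T))]
        rw [abs_div, abs_of_pos hxT, div_le_iff₀ hxT]
        have hn : 0 ≤ ∫ σ in (-T)..T, K1 (t + σ) (x + T) := le_trans (abs_nonneg _) hle
        have : (1 / T * ∫ σ in (-T)..T, K1 (t + σ) (x + T)) * (x + T)
            = (∫ σ in (-T)..T, K1 (t + σ) (x + T)) * (1 + x / T) := by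
          field_simp; ring
        rw [this]
        have : 0 ≤ x / T := by apply div_nonneg <;> linarith
        nlinarith
      have i2 : |(∫ σ in (-T)..T, W (t + σ) (x + T)) / (x + T) ^ 2| ≤ 2 * ε := by
        have hb : |∫ σ in (-T)..T, W (t + σ) (x + T)| ≤ (ε * (x + T)) * |T - (-T)| := by
          refine intervalIntegral.norm_integral_le_of_norm_le_const
            (f := fun σ => W (t + σ) (x + T)) ?_
          intro σ _
          have := hT3 (t + σ) (x + T) (by linarith)
          rw [div_le_iff₀ hxT] at this
          exact this
        rw [abs_of_nonneg (show 0 ≤ T - (-T) by linarith)] at hb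
        rw [abs_div, abs_of_pos (show 0 < (x + T) ^ 2 by positivity), div_le_iff₀ (by positivity)]
        have : ε * (x + T) * (T - (-T)) ≤ 2 * ε * (x + T) ^ 2 := by
          have : 0 ≤ ε * (x + T) * x := by
            have : 0 < x := by linarith
            positivity
          nlinarith
        linarith
      simp only [hK1]
      have a1 := le_abs_self (pD2 W (t - T) (x + T))
      have a1' := neg_abs_le (pD2 W (t - T) (x + T))
      have a2 := le_abs_self (pD1 W (t - T) (x + T))
      have a2' := neg_abs_le (pD1 W (t - T) (x + T))
      have a3 := le_abs_self (pD2 W (t + T) (x + T))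
      have a3' := neg_abs_le (pD2 W (t + T) (x + T))
      have a4 := le_abs_self (pD1 W (t + T) (x + T))
      have a4' := neg_abs_le (pD1 W (t + T) (x + T))
      rw [abs_le] at w1 w2 i1 i2
      simp only [hK1] at i1
      unfold Efun
      rw [abs_le]
      constructor <;> linarith [w1.1, w1.2, w2.1, w2.2, i1.1, i1.2, i2.1, i2.2]
    have hpt : ∀ x ∈ Set.Icc r1 r2, |W t x + x * pD2 W t x| ≤ 2 * x * G x
        + r2 / 2 * (K1 (t - T) (x + T) + K1 (t + T) (x + T) + 4 * ε
        + (1 / T) * ∫ σ in (-T)..T, K1 (t + σ) (x + T)) := by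
      intro x hx
      have hx0 : 0 < x := by linarith [hx.1]
      have e1 := Efun_bound h hR hf hG hG0 t x T (by linarith [hx.1]) (by linarith)
      have e2 := hEb x hx.1
      have e3 : W t x + x * pD2 W t x = x / 2 * (2 * (pD2 W t x + W t x / x)) := by
        field_simp; ring
      rw [e3, abs_mul, abs_of_pos (show 0 < x / 2 by linarith)]
      have e4 := abs_nonneg (Efun W t x T)
      have e5 : x / 2 * |Efun W t x T| ≤ r2 / 2 * |Efun W t x T| := by
        apply mul_le_mul_of_nonneg_right _ e4
        linarith [hx.2]
      have e6 := mul_le_mul_of_nonneg_left e2 (show 0 ≤ r2 / 2 by linarith)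
      have e7 := mul_le_mul_of_nonneg_left e1 (show 0 ≤ x / 2 by linarith)
      nlinarith
    have hswap : ∫ x in r1..r2, ∫ σ in (-T)..T, K1 (t + σ) (x + T)
        = ∫ σ in (-T)..T, ∫ x in r1..r2, K1 (t + σ) (x + T) := by
      apply MeasureTheory.intervalIntegral_intervalIntegral_swap
      refine IntegrableOn.mono_set (t := Set.uIcc r1 r2 ×ˢ Set.uIcc (-T) T) ?_ ?_
      · exact ContinuousOn.integrableOn_compact (isCompact_uIcc.prod isCompact_uIcc)
          (hK1c2.continuousOn)
      · exact Set.prod_mono Set.uIoc_subset_uIcc Set.uIoc_subset_uIcc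
    have hIb : ∫ x in r1..r2, ∫ σ in (-T)..T, K1 (t + σ) (x + T) ≤ 2 * T * ε := by
      rw [hswap]
      have := intervalIntegral.norm_integral_le_of_norm_le_const (a := -T) (b := T) (C := ε)
        (f := fun σ => ∫ x in r1..r2, K1 (t + σ) (x + T)) ?_
      · rw [abs_of_nonneg (show 0 ≤ T - (-T) by linarith)] at this
        have h3 := le_norm_self (∫ σ in (-T)..T, ∫ x in r1..r2, K1 (t + σ) (x + T))
        linarith
      · intro σ _
        rw [Real.norm_eq_abs, abs_of_nonneg]
        · exact hT2 (t + σ)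
        · apply intervalIntegral.integral_nonneg h2
          intro x _
          simp only [hK1]; positivity
    have hcM : Continuous (fun x => K1 (t - T) (x + T) + K1 (t + T) (x + T) + 4 * ε
        + (1 / T) * ∫ σ in (-T)..T, K1 (t + σ) (x + T)) :=
      (((hsl _).add (hsl _)).add continuous_const).add (continuous_const.mul hIc)
    have hMint : ∫ x in r1..r2, (K1 (t - T) (x + T) + K1 (t + T) (x + T) + 4 * ε
        + (1 / T) * ∫ σ in (-T)..T, K1 (t + σ) (x + T)) ≤ (4 + 4 * (r2 - r1)) * ε := by
      have z1 : Continuous (fun x => K1 (t - T) (x + T) + K1 (t + T) (x + T)) :=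
        (hsl _).add (hsl _)
      have z2 : Continuous (fun x => K1 (t - T) (x + T) + K1 (t + T) (x + T) + 4 * ε) :=
        z1.add continuous_const
      have z3 : Continuous (fun x => (1 / T) * ∫ σ in (-T)..T, K1 (t + σ) (x + T)) :=
        continuous_const.mul hIc
      rw [intervalIntegral.integral_add (z2.intervalIntegrable _ _) (z3.intervalIntegrable _ _),
        intervalIntegral.integral_add (z1.intervalIntegrable _ _)
        (continuous_const.intervalIntegrable _ _),
        intervalIntegral.integral_add ((hsl _).intervalIntegrable _ _)
        ((hsl _).intervalIntegrable _ _), intervalIntegral.integral_const,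
        intervalIntegral.integral_const_mul]
      have q1 := hT2 (t - T)
      have q2 := hT2 (t + T)
      have q3 : (1 / T) * ∫ x in r1..r2, ∫ σ in (-T)..T, K1 (t + σ) (x + T) ≤ 2 * ε := by
        rw [one_div, inv_mul_le_iff₀ (by linarith)]
        linarith
      simp only [smul_eq_mul]
      linarith
    rw [hFTC, ← hKint]
    refine (intervalIntegral.abs_integral_le_integral_abs h2).trans ?_
    have hWc : Continuous (fun x => |W t x + x * pD2 W t x|) := by
      have cc1 : Continuous (fun x => W t x) := h.one.cont.comp (Continuous.prodMk_right t)
      have cc2 : Continuous (fun x => pD2 W t x) := (pD2_cont h.one).comp (Continuous.prodMk_right t)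
      fun_prop
    have hcM2 : Continuous (fun x => r2 / 2 * (K1 (t - T) (x + T) + K1 (t + T) (x + T) + 4 * ε
        + (1 / T) * ∫ σ in (-T)..T, K1 (t + σ) (x + T))) := continuous_const.mul hcM
    refine (intervalIntegral.integral_mono_on h2 (hWc.intervalIntegrable _ _)
      (hKii.add (hcM2.intervalIntegrable _ _)) hpt).trans ?_
    rw [intervalIntegral.integral_add hKii (hcM2.intervalIntegrable _ _),
      intervalIntegral.integral_const_mul]
    have := mul_le_mul_of_nonneg_left hMint (show 0 ≤ r2 / 2 by linarith)
    linarith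
  refine le_of_forall_pos_le_add fun δ hδ => ?_
  have hC : 0 < r2 / 2 * (4 + 4 * (r2 - r1)) := by
    apply mul_pos <;> linarith
  have := main (δ / (r2 / 2 * (4 + 4 * (r2 - r1)))) (by positivity)
  rwa [mul_div_cancel₀ _ hC.ne'] at this

def TailHyp (W : ℝ → ℝ → ℝ) : Prop :=
  ∀ ε, 0 < ε → ∀ r1 r2 : ℝ, 1 ≤ r1 → r1 ≤ r2 → ∃ T, 1 ≤ T ∧
      (∀ t, ∫ x in r1..r2, (|pD2 W t (x + T)| + |pD1 W t (x + T)|) ≤ ε) ∧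
      ∀ t x, T ≤ x → |W t x| / x ≤ ε

theorem pow_step {W : ℝ → ℝ → ℝ} (h : PC 2 W) {C0 M R k : ℝ} (hR : 1 ≤ R) (hC0 : 0 ≤ C0)
    (hM : 0 ≤ M) (hk : k ≠ 0) (hk2 : 0 < 2 + k)
    (hf : ∀ t r, R ≤ r → |forc W t r| ≤ C0 * |W t r| * r ^ (-3 : ℝ))
    (hW : ∀ t r, R ≤ r → |W t r| ≤ M * r ^ (-k))
    (htail : TailHyp W) (t r1 r2 : ℝ) (h1 : R ≤ r1) (h2 : r1 ≤ r2) :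
    |r2 * W t r2 - r1 * W t r1| ≤ 2 * C0 * M / ((2 + k) * (-k)) * (r2 ^ (-k) - r1 ^ (-k)) := by
  have := lateral_estimate h (g := fun r => C0 * M * r ^ (-3 - k))
    (G := fun r => C0 * M / (2 + k) * r ^ (-2 - k))
    (K := fun r => 2 * C0 * M / ((2 + k) * (-k)) * r ^ (-k)) (R := R) (by linarith)
    ?_ ?_ ?_ ?_ (fun ε hε r1 r2 h1 h2 => htail ε hε r1 r2 (by linarith) h2) t r1 r2 h1 h2
  · refine this.trans (le_of_eq ?_); ring
  · intro t r hr
    have hr0 : 0 < r := by linarith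
    refine (hf t r hr).trans ?_
    rw [show (-3 - k : ℝ) = -k + -3 by ring, Real.rpow_add hr0]
    have a := hW t r hr
    have b : 0 ≤ r ^ (-3 : ℝ) := by positivity
    calc C0 * |W t r| * r ^ (-3 : ℝ) ≤ C0 * (M * r ^ (-k)) * r ^ (-3 : ℝ) := by gcongr
      _ = _ := by ring
  · intro r hr
    have hr0 : 0 < r := by linarith
    have := (Real.hasDerivAt_rpow_const (x := r) (p := -2 - k) (Or.inl hr0.ne')).const_mul
      (C0 * M / (2 + k))
    refine this.congr_deriv ?_
    rw [show (-2 - k - 1 : ℝ) = -3 - k by ring]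
    field_simp
    ring
  · intro r hr
    have hr0 : 0 < r := by linarith
    positivity
  · intro r hr
    have hr0 : 0 < r := by linarith
    have := (Real.hasDerivAt_rpow_const (x := r) (p := -k) (Or.inl hr0.ne')).const_mul
      (2 * C0 * M / ((2 + k) * (-k)))
    refine this.congr_deriv ?_
    rw [show (-k - 1 : ℝ) = 1 + (-2 - k) by ring, Real.rpow_add hr0, Real.rpow_one]
    field_simp

theorem limit_exists (C C0 R : ℝ) (hR : 1 ≤ R) (hC : 0 ≤ C) (hC0 : 0 ≤ C0) :
    ∃ C4, 0 ≤ C4 ∧ ∀ W : ℝ → ℝ → ℝ, PC 2 W →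
      (∀ t r, R ≤ r → |forc W t r| ≤ C0 * |W t r| * r ^ (-3 : ℝ)) →
      (∀ t r, R ≤ r → |W t r| ≤ C * r ^ (1 / 2 : ℝ)) → TailHyp W →
      ∃ l : ℝ → ℝ, (∀ t, |l t| ≤ C4) ∧
        ∀ t r, R ≤ r → |r * W t r - l t| ≤ C4 * r ^ (-(1 / 2) : ℝ) := by
  set B : ℝ := 2 * C0 * C / ((2 + -(1 / 2)) * (- -(1 / 2))) with hB
  set C2 : ℝ := R * (C * R ^ (1 / 2 : ℝ)) + B with hC2
  set C3 : ℝ := 2 * C0 * C2 / ((2 + (1 / 2)) * (1 / 2)) with hC3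
  have hB0 : 0 ≤ B := by rw [hB]; norm_num; positivity
  have hC20 : 0 ≤ C2 := by positivity
  have hC30 : 0 ≤ C3 := by positivity
  refine ⟨C3 + R * (C * R ^ (1 / 2 : ℝ)), by positivity, ?_⟩
  intro W h hf hW htail
  have s1 := fun t r (hr : R ≤ r) => pow_step h (k := -(1 / 2)) hR hC0 hC (by norm_num) (by norm_num) hf
    (by intro t r hr; rw [neg_neg]; exact hW t r hr) htail t R r le_rfl hr
  have w2 : ∀ t r, R ≤ r → |W t r| ≤ C2 * r ^ (-(1 / 2) : ℝ) := by
    intro t r hr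
    have hr0 : 0 < r := by linarith
    have e1 := s1 t r hr
    rw [neg_neg] at e1
    have hB' : 2 * C0 * C / ((2 + -(1 / 2)) * (1 / 2)) = B := by rw [hB]; norm_num
    rw [hB'] at e1
    have e2 := hW t R le_rfl
    have hp : 0 ≤ R ^ (1 / 2 : ℝ) := by positivity
    have hp1 : 1 ≤ r ^ (1 / 2 : ℝ) := Real.one_le_rpow (by linarith) (by norm_num)
    have e3 : |r * W t r| ≤ C2 * r ^ (1 / 2 : ℝ) := by
      have e4 : |r * W t r| ≤ |r * W t r - R * W t R| + |R * W t R| := by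
        have := abs_add_le (r * W t r - R * W t R) (R * W t R)
        simpa using this
      have e5 : |R * W t R| ≤ R * (C * R ^ (1 / 2 : ℝ)) := by
        rw [abs_mul, abs_of_pos (show 0 < R by linarith)]
        gcongr
      have e6 : 0 ≤ R * (C * R ^ (1 / 2 : ℝ)) := by positivity
      have e7 := mul_nonneg hB0 hp
      rw [hC2]
      nlinarith
    rw [abs_mul, abs_of_pos hr0] at e3
    rw [show (-(1 / 2) : ℝ) = 1 / 2 - 1 by norm_num, Real.rpow_sub_one hr0.ne', ← mul_div_assoc,
      le_div_iff₀ hr0]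
    linarith
  have s2 : ∀ t r1 r2, R ≤ r1 → r1 ≤ r2 →
      |r2 * W t r2 - r1 * W t r1| ≤ C3 * r1 ^ (-(1 / 2) : ℝ) := by
    intro t r1 r2 h1 h2
    have := pow_step h (k := 1 / 2) hR hC0 hC20 (by norm_num) (by norm_num) hf
      w2 htail t r1 r2 h1 h2
    have e : 2 * C0 * C2 / ((2 + 1 / 2) * (-(1 / 2))) = -C3 := by
      rw [hC3, mul_neg, div_neg]
    rw [e] at this
    have : 0 ≤ C3 * r2 ^ (-(1 / 2) : ℝ) := by
      have : 0 < r2 := by linarith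
      positivity
    linarith
  have lim0 : Tendsto (fun r : ℝ => C3 * r ^ (-(1 / 2) : ℝ)) atTop (nhds 0) := by
    have := (tendsto_rpow_neg_atTop (show (0:ℝ) < 1 / 2 by norm_num)).const_mul C3
    simpa using this
  have hcau : ∀ t, ∃ l, Tendsto (fun r => r * W t r) atTop (nhds l) := by
    intro t
    apply cauchySeq_tendsto_of_complete
    rw [Metric.cauchySeq_iff']
    intro ε hε
    obtain ⟨N, hN⟩ := ((lim0.eventually (gt_mem_nhds hε)).and (eventually_ge_atTop R)).exists
    refine ⟨N, fun n hn => ?_⟩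
    rw [Real.dist_eq]
    exact (s2 t N n hN.2 hn).trans_lt hN.1
  choose l hl using hcau
  have key : ∀ t r, R ≤ r → |r * W t r - l t| ≤ C3 * r ^ (-(1 / 2) : ℝ) := by
    intro t r hr
    have : Tendsto (fun r2 => |r2 * W t r2 - r * W t r|) atTop (nhds |l t - r * W t r|) :=
      ((hl t).sub_const _).abs
    rw [abs_sub_comm]
    refine le_of_tendsto this ?_
    filter_upwards [eventually_ge_atTop r] with r2 hr2
    exact s2 t r r2 hr hr2
  have e6 : 0 ≤ R * (C * R ^ (1 / 2 : ℝ)) := by positivity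
  refine ⟨l, fun t => ?_, fun t r hr => (key t r hr).trans ?_⟩
  · have e1 := key t R le_rfl
    have e5 : |R * W t R| ≤ R * (C * R ^ (1 / 2 : ℝ)) := by
      rw [abs_mul, abs_of_pos (show 0 < R by linarith)]
      have := hW t R le_rfl
      gcongr
    have e7 : R ^ (-(1 / 2) : ℝ) ≤ 1 := Real.rpow_le_one_of_one_le_of_nonpos hR (by norm_num)
    have e8 : |l t| ≤ |R * W t R - l t| + |R * W t R| := by
      have := abs_sub_abs_le_abs_sub (l t) (R * W t R)
      rw [abs_sub_comm] at this; linarith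
    nlinarith
  · have : 0 < r := by linarith
    gcongr
    linarith

theorem contraction {W : ℝ → ℝ → ℝ} (h : PC 2 W) {C0 M R : ℝ} (hR : 1 ≤ R) (hC0 : 0 ≤ C0)
    (hM : 0 ≤ M) (hRC : 2 * C0 ≤ R)
    (hf : ∀ t r, R ≤ r → |forc W t r| ≤ C0 * |W t r| * r ^ (-3 : ℝ))
    (hW : ∀ t r, R ≤ r → |W t r| ≤ M * r ^ (-1 : ℝ))
    (hl : ∀ t, Tendsto (fun r => r * W t r) atTop (nhds 0))
    (htail : TailHyp W) : ∀ t r, R ≤ r → W t r = 0 := by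
  have step : ∀ M, 0 ≤ M → (∀ t r, R ≤ r → |W t r| ≤ M * r ^ (-1 : ℝ)) →
      ∀ t r, R ≤ r → |W t r| ≤ (M / 2) * r ^ (-1 : ℝ) := by
    intro M hM hW t r hr
    have hr0 : 0 < r := by linarith
    have e0 : ∀ r2, r ≤ r2 → |r2 * W t r2 - r * W t r| ≤ M / 2 := by
      intro r2 hr2
      have := pow_step h (k := 1) hR hC0 hM (by norm_num) (by norm_num) hf hW htail t r r2 hr hr2
      have hr20 : 0 < r2 := by linarith
      rw [Real.rpow_neg_one, Real.rpow_neg_one] at this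
      refine this.trans ?_
      have p2 : 0 < r2⁻¹ := by positivity
      have p1 : r⁻¹ * (2 * C0) ≤ 1 := by
        rw [inv_mul_le_iff₀ hr0]; linarith
      have : 2 * C0 * M / ((2 + 1) * (-1)) * (r2⁻¹ - r⁻¹)
          = (r⁻¹ * (2 * C0)) * M / 3 - 2 * C0 * M * r2⁻¹ / 3 := by ring
      rw [this]
      have : 0 ≤ 2 * C0 * M * r2⁻¹ / 3 := by positivity
      nlinarith
    have : Tendsto (fun r2 => |r2 * W t r2 - r * W t r|) atTop (nhds |0 - r * W t r|) :=
      ((hl t).sub_const _).abs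
    have e1 : |0 - r * W t r| ≤ M / 2 := by
      refine le_of_tendsto this ?_
      filter_upwards [eventually_ge_atTop r] with r2 hr2
      exact e0 r2 hr2
    rw [zero_sub, abs_neg, abs_mul, abs_of_pos hr0] at e1
    rw [Real.rpow_neg_one, ← div_eq_mul_inv, le_div_iff₀ hr0]
    linarith
  have it : ∀ n : ℕ, ∀ t r, R ≤ r → |W t r| ≤ (M / 2 ^ n) * r ^ (-1 : ℝ) := by
    intro n
    induction n with
    | zero => simpa using hW
    | succ n ih =>
      have := step (M / 2 ^ n) (by positivity) ih
      intro t r hr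
      have := this t r hr
      rwa [div_div, ← pow_succ] at this
  intro t r hr
  have lim : Tendsto (fun n : ℕ => (M / 2 ^ n) * r ^ (-1 : ℝ)) atTop (nhds 0) := by
    have := (tendsto_pow_atTop_nhds_zero_of_lt_one (show (0:ℝ) ≤ 1 / 2 by norm_num)
      (by norm_num)).const_mul (M * r ^ (-1 : ℝ))
    rw [mul_zero] at this
    refine this.congr fun n => ?_
    rw [one_div, inv_pow]; ring
  have := ge_of_tendsto' lim fun n => it n t r hr
  exact abs_nonpos_iff.mp this

theorem lateral_step {W : ℝ → ℝ → ℝ} (h : PC 2 W) {R S : ℝ} (hS : 0 ≤ S)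
    (hg : ∀ t r, |pD2 (pD2 W) t r - pD1 (pD1 W) t r| ≤ 3 * |W t r|)
    (h0 : ∀ t r, R < r → W t r = 0) (hb : ∀ t r, R - 1 / 2 < r → |W t r| ≤ S) :
    ∀ t r, R - 1 / 2 < r → |W t r| ≤ 3 / 4 * S := by
  have d0 : ∀ t r, R < r → pD1 W t r = 0 ∧ pD2 W t r = 0 := by
    intro t r hr
    constructor
    · have : (fun s => W s r) = fun _ => 0 := by funext s; exact h0 s r hr
      simp [pD1, this]
    · have : W t =ᶠ[nhds r] fun _ => 0 := by
        filter_upwards [lt_mem_nhds hr] with x hx using h0 t x hx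
      simp [pD2, this.deriv_eq]
  have hder : ∀ t r, R - 1 / 2 < r → |pD2 W t r| ≤ 3 / 2 * S := by
    intro t r hr
    have p1 := norm_image_sub_le_of_norm_deriv_le_segment' (a := 0) (b := 1 / 2) (C := 3 * S)
      (f := fun σ => pD1 W (t - σ) (r + σ) + pD2 W (t - σ) (r + σ))
      (f' := fun σ => pD2 (pD2 W) (t - σ) (r + σ) - pD1 (pD1 W) (t - σ) (r + σ)) ?_ ?_
      (1 / 2) ⟨by norm_num, le_rfl⟩
    · have p2 := norm_image_sub_le_of_norm_deriv_le_segment' (a := 0) (b := 1 / 2) (C := 3 * S)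
        (f := fun σ => pD1 W (t + σ) (r + σ) - pD2 W (t + σ) (r + σ))
        (f' := fun σ => -(pD2 (pD2 W) (t + σ) (r + σ) - pD1 (pD1 W) (t + σ) (r + σ))) ?_ ?_
        (1 / 2) ⟨by norm_num, le_rfl⟩
      · obtain ⟨a1, a2⟩ := d0 (t - 1 / 2) (r + 1 / 2) (by linarith)
        obtain ⟨b1, b2⟩ := d0 (t + 1 / 2) (r + 1 / 2) (by linarith)
        simp only [a1, a2, b1, b2, add_zero, sub_zero, zero_sub, norm_neg, Real.norm_eq_abs] at p1 p2
        rw [abs_le] at p1 p2 ⊢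
        constructor <;> linarith [p1.1, p1.2, p2.1, p2.2]
      · intro σ hσ
        have := (diagP (pD1_C h) t r σ).sub (diagP (pD2_C h) t r σ)
        refine (this.congr_deriv ?_).hasDerivWithinAt
        rw [pD_symm h]; ring
      · intro σ hσ
        rw [norm_neg]
        refine (hg _ _).trans ?_
        have := hb (t + σ) (r + σ) (by linarith [hσ.1])
        linarith
    · intro σ hσ
      have := (diagM (pD1_C h) t r σ).add (diagM (pD2_C h) t r σ)
      refine (this.congr_deriv ?_).hasDerivWithinAt
      rw [pD_symm h]; ring
    · intro σ hσ
      refine (hg _ _).trans ?_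
      have := hb (t - σ) (r + σ) (by linarith [hσ.1])
      linarith
  intro t r hr
  have p := norm_image_sub_le_of_norm_deriv_le_segment' (a := r) (b := r + 1 / 2) (C := 3 / 2 * S)
    (f := W t) (f' := pD2 W t) (fun x _ => (pD2_hasDerivAt h.one t x).hasDerivWithinAt)
    (fun x hx => hder t x (by linarith [hx.1])) (r + 1 / 2) ⟨by linarith, le_rfl⟩
  rw [h0 t (r + 1 / 2) (by linarith), zero_sub, norm_neg, Real.norm_eq_abs] at p
  linarith

theorem lateral_unique {W : ℝ → ℝ → ℝ} (h : PC 2 W) {R S : ℝ}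
    (hg : ∀ t r, |pD2 (pD2 W) t r - pD1 (pD1 W) t r| ≤ 3 * |W t r|)
    (h0 : ∀ t r, R < r → W t r = 0)
    (hb : ∀ t r, |W t r| ≤ S * (r ^ 2 + 1)) : ∀ t r, W t r = 0 := by
  have one : ∀ R, (∀ t r, R < r → W t r = 0) → ∀ t r, R - 1 / 2 < r → W t r = 0 := by
    intro R h0
    have hS : 0 ≤ S := by
      have := (abs_nonneg _).trans (hb 0 0)
      simpa using this
    set B := S * ((|R| + 1) ^ 2 + 1) with hB
    have hB0 : 0 ≤ B := by positivity
    have hbB : ∀ t r, R - 1 / 2 < r → |W t r| ≤ B := by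
      intro t r hr
      by_cases hr2 : R < r
      · rw [h0 t r hr2, abs_zero]; exact hB0
      · refine (hb t r).trans ?_
        have : |r| ≤ |R| + 1 := by
          push Not at hr2
          rw [abs_le]
          constructor
          · linarith [neg_abs_le R]
          · linarith [le_abs_self R]
        have : r ^ 2 ≤ (|R| + 1) ^ 2 := by
          rw [← sq_abs r]
          gcongr
        rw [hB]
        gcongr
    have it : ∀ n : ℕ, ∀ t r, R - 1 / 2 < r → |W t r| ≤ (3 / 4) ^ n * B := by
      intro n
      induction n with
      | zero => simpa using hbB
      | succ n ih =>
        intro t r hr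
        have := lateral_step h (by positivity) hg h0 ih t r hr
        rw [pow_succ]; linarith
    intro t r hr
    have lim : Tendsto (fun n : ℕ => (3 / 4 : ℝ) ^ n * B) atTop (nhds 0) := by
      have := (tendsto_pow_atTop_nhds_zero_of_lt_one (show (0:ℝ) ≤ 3 / 4 by norm_num)
        (by norm_num)).mul_const B
      simpa using this
    have := ge_of_tendsto' lim fun n => it n t r hr
    exact abs_nonpos_iff.mp this
  have all : ∀ n : ℕ, ∀ t r, R - n * (1 / 2) < r → W t r = 0 := by
    intro n
    induction n with
    | zero => simpa using h0
    | succ n ih =>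
      intro t r hr
      refine one _ ih t r ?_
      push_cast at hr
      linarith
  intro t r
  obtain ⟨n, hn⟩ := exists_nat_gt (2 * (R - r))
  exact all n t r (by linarith)

noncomputable def en (u : ℝ → ℝ → ℝ) (t r : ℝ) : ℝ :=
  ((pD2 u t r) ^ 2 + (pD1 u t r) ^ 2) * (r ^ 2 + 1) ^ 2

theorem en_nonneg (u : ℝ → ℝ → ℝ) (t r : ℝ) : 0 ≤ en u t r := by unfold en; positivity

theorem en_cont {u : ℝ → ℝ → ℝ} (h : PC 1 u) (t : ℝ) : Continuous (fun r => en u t r) := by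
  have h1 : Continuous (fun r => pD1 u t r) := (pD1_cont h).comp (Continuous.prodMk_right t)
  have h2 : Continuous (fun r => pD2 u t r) := (pD2_cont h).comp (Continuous.prodMk_right t)
  unfold en
  fun_prop

theorem en_cover {u : ℝ → ℝ → ℝ} (h : PC 1 u) (hfin : FiniteEnergyReduced u)
    (hcomp : TotallyBoundedTraj u) (ε : ℝ) (hε : 0 < ε) :
    ∃ (N : ℕ) (ts : Fin N → ℝ), ∀ t, ∃ i : Fin N, ∀ a b, a ≤ b →
      ∫ r in a..b, en u t r ≤ ε + 2 * ∫ r in a..b, en u (ts i) r := by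
  obtain ⟨N, ts, hts⟩ := hcomp (Real.sqrt (ε / 2)) (Real.sqrt_pos.2 (by linarith))
  refine ⟨N, ts, fun t => ?_⟩
  obtain ⟨i, hi⟩ := hts t
  refine ⟨i, fun a b hab => ?_⟩
  set D : ℝ → ℝ := fun r => ((deriv (u t) r - deriv (u (ts i)) r) ^ 2 +
        (deriv (fun s => u s r) t - deriv (fun s => u s r) (ts i)) ^ 2) * (r ^ 2 + 1) ^ 2 with hD
  have hDn : ∀ r, 0 ≤ D r := fun r => by simp only [hD]; positivity
  have h1 : ∀ t, Continuous (fun r => pD1 u t r) :=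
    fun t => (pD1_cont h).comp (Continuous.prodMk_right t)
  have h2 : ∀ t, Continuous (fun r => pD2 u t r) :=
    fun t => (pD2_cont h).comp (Continuous.prodMk_right t)
  have hDc : Continuous D := by
    have e1 := h1 t
    have e2 := h2 t
    have e3 := h1 (ts i)
    have e4 := h2 (ts i)
    change Continuous (fun r => ((pD2 u t r - pD2 u (ts i) r) ^ 2 +
        (pD1 u t r - pD1 u (ts i) r) ^ 2) * (r ^ 2 + 1) ^ 2)
    fun_prop
  have hDe : ∀ r, D r ≤ 2 * en u t r + 2 * en u (ts i) r := by
    intro r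
    change ((pD2 u t r - pD2 u (ts i) r) ^ 2 +
        (pD1 u t r - pD1 u (ts i) r) ^ 2) * (r ^ 2 + 1) ^ 2 ≤ _
    unfold en
    have : (0:ℝ) ≤ (r ^ 2 + 1) ^ 2 := by positivity
    have h3 : (pD2 u t r - pD2 u (ts i) r) ^ 2 + (pD1 u t r - pD1 u (ts i) r) ^ 2 ≤
      2 * ((pD2 u t r) ^ 2 + (pD1 u t r) ^ 2) + 2 * ((pD2 u (ts i) r) ^ 2 + (pD1 u (ts i) r) ^ 2) := by
      nlinarith [sq_nonneg (pD2 u t r + pD2 u (ts i) r), sq_nonneg (pD1 u t r + pD1 u (ts i) r)]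
    nlinarith [mul_le_mul_of_nonneg_right h3 this]
  have heD : ∀ r, en u t r ≤ 2 * D r + 2 * en u (ts i) r := by
    intro r
    change _ ≤ 2 * (((pD2 u t r - pD2 u (ts i) r) ^ 2 +
        (pD1 u t r - pD1 u (ts i) r) ^ 2) * (r ^ 2 + 1) ^ 2) + _
    unfold en
    have : (0:ℝ) ≤ (r ^ 2 + 1) ^ 2 := by positivity
    have h3 : (pD2 u t r) ^ 2 + (pD1 u t r) ^ 2 ≤
      2 * ((pD2 u t r - pD2 u (ts i) r) ^ 2 + (pD1 u t r - pD1 u (ts i) r) ^ 2)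
        + 2 * ((pD2 u (ts i) r) ^ 2 + (pD1 u (ts i) r) ^ 2) := by
      nlinarith [sq_nonneg (pD2 u t r - 2 * pD2 u (ts i) r), sq_nonneg (pD1 u t r - 2 * pD1 u (ts i) r)]
    nlinarith [mul_le_mul_of_nonneg_right h3 this]
  have hei : ∀ t, Integrable (fun r => en u t r) := hfin
  have hDi : Integrable D := by
    refine Integrable.mono' (((hei t).const_mul 2).add ((hei (ts i)).const_mul 2))
      hDc.aestronglyMeasurable (Eventually.of_forall fun r => ?_)
    rw [Real.norm_of_nonneg (hDn r)]
    exact hDe r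
  have hDI : ∫ r, D r ≤ ε / 2 := by
    have h0 : 0 ≤ ∫ r, D r := integral_nonneg hDn
    exact ((Real.sqrt_lt_sqrt_iff h0).1 hi).le
  have hDI2 : ∫ r in a..b, D r ≤ ε / 2 := by
    rw [intervalIntegral.integral_of_le hab]
    exact (setIntegral_le_integral hDi (Eventually.of_forall hDn)).trans hDI
  have c1 : Continuous (fun r => 2 * D r) := by fun_prop
  have c2 : Continuous (fun r => 2 * en u (ts i) r) := (en_cont h (ts i)).const_mul 2 |> fun h => by simpa using h
  calc ∫ r in a..b, en u t r ≤ ∫ r in a..b, (2 * D r + 2 * en u (ts i) r) :=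
        intervalIntegral.integral_mono_on hab ((en_cont h t).intervalIntegrable _ _)
          ((c1.add c2).intervalIntegrable _ _) (fun r _ => heD r)
    _ = 2 * (∫ r in a..b, D r) + 2 * ∫ r in a..b, en u (ts i) r := by
        rw [intervalIntegral.integral_add (c1.intervalIntegrable _ _) (c2.intervalIntegrable _ _),
          intervalIntegral.integral_const_mul, intervalIntegral.integral_const_mul]
    _ ≤ _ := by linarith

theorem en_bdd {u : ℝ → ℝ → ℝ} (h : PC 1 u) (hfin : FiniteEnergyReduced u)
    (hcomp : TotallyBoundedTraj u) :
    ∃ B, 0 ≤ B ∧ ∀ t a b, a ≤ b → ∫ r in a..b, en u t r ≤ B := by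
  obtain ⟨N, ts, hts⟩ := en_cover h hfin hcomp 1 one_pos
  have hei : ∀ t, Integrable (fun r => en u t r) := hfin
  have h0 : ∀ i, 0 ≤ ∫ r, en u (ts i) r := fun i => integral_nonneg (en_nonneg u (ts i))
  refine ⟨1 + 2 * ∑ i, ∫ r, en u (ts i) r, by
    have := Finset.sum_nonneg (s := Finset.univ) (fun i _ => h0 i); linarith, fun t a b hab => ?_⟩
  obtain ⟨i, hi⟩ := hts t
  refine (hi a b hab).trans ?_
  have h1 : ∫ r in a..b, en u (ts i) r ≤ ∫ r, en u (ts i) r := by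
    rw [intervalIntegral.integral_of_le hab]
    exact setIntegral_le_integral (hei _) (Eventually.of_forall (en_nonneg u _))
  have h2 := Finset.single_le_sum (f := fun i => ∫ r, en u (ts i) r) (fun i _ => h0 i)
    (Finset.mem_univ i)
  linarith

theorem en_tail {u : ℝ → ℝ → ℝ} (h : PC 1 u) (hfin : FiniteEnergyReduced u)
    (hcomp : TotallyBoundedTraj u) (ε : ℝ) (hε : 0 < ε) :
    ∃ R, 1 ≤ R ∧ ∀ t a b, R ≤ a → a ≤ b → ∫ r in a..b, en u t r ≤ ε := by
  obtain ⟨N, ts, hts⟩ := en_cover h hfin hcomp (ε / 2) (by linarith)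
  have hei : ∀ t, Integrable (fun r => en u t r) := hfin
  have key : ∀ i, ∀ᶠ R in atTop, ∀ a b, R ≤ a → a ≤ b → ∫ r in a..b, en u (ts i) r ≤ ε / 4 := by
    intro i
    have ht := intervalIntegral_tendsto_integral_Ioi 0 (hei (ts i)).integrableOn tendsto_id
    have he := Metric.tendsto_atTop.1 ht (ε / 8) (by linarith)
    obtain ⟨R, hR⟩ := he
    filter_upwards [eventually_ge_atTop R] with R' hR' a b ha hab
    have h1 := hR a (by linarith)
    have h2 := hR b (by linarith)
    rw [Real.dist_eq, abs_lt] at h1 h2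
    have hc := en_cont h (ts i)
    have := intervalIntegral.integral_interval_sub_left (a := 0) (b := b) (c := a) (μ := volume)
      (hc.intervalIntegrable _ _) (hc.intervalIntegrable _ _)
    rw [← this]
    simp only [id] at h1 h2
    linarith [h1.1, h1.2, h2.1, h2.2]
  obtain ⟨R, hR, hR1⟩ := ((eventually_all.2 key).and (eventually_ge_atTop 1)).exists
  refine ⟨R, hR1, fun t a b ha hab => ?_⟩
  obtain ⟨i, hi⟩ := hts t
  have h3 := hR i a b ha hab
  have h4 := hi a b hab
  linarith

theorem osc {u : ℝ → ℝ → ℝ} (h : PC 1 u) (t a b : ℝ) (hab : a ≤ b) (η : ℝ) (hη : 0 < η) :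
    |u t b - u t a| ≤ (η * (∫ r in a..b, en u t r) + η⁻¹ * ∫ r in a..b, ((r ^ 2 + 1) ^ 2)⁻¹) / 2 := by
  have h2 : Continuous (fun r => pD2 u t r) := (pD2_cont h).comp (Continuous.prodMk_right t)
  have hFTC : ∫ r in a..b, pD2 u t r = u t b - u t a :=
    intervalIntegral.integral_eq_sub_of_hasDerivAt (fun r _ => pD2_hasDerivAt h t r)
      (h2.intervalIntegrable _ _)
  rw [← hFTC]
  have c1 : Continuous (fun r => η / 2 * en u t r) := (en_cont h t).const_mul (η / 2) |> fun h => by simpa using h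
  have c2 : Continuous (fun r : ℝ => η⁻¹ / 2 * ((r ^ 2 + 1) ^ 2)⁻¹) := by
    refine continuous_const.mul (Continuous.inv₀ (by fun_prop) fun r => by positivity)
  calc |∫ r in a..b, pD2 u t r| ≤ ∫ r in a..b, |pD2 u t r| :=
        intervalIntegral.abs_integral_le_integral_abs hab
    _ ≤ ∫ r in a..b, (η / 2 * en u t r + η⁻¹ / 2 * ((r ^ 2 + 1) ^ 2)⁻¹) := by
        refine intervalIntegral.integral_mono_on hab (h2.abs.intervalIntegrable _ _)
          ((c1.add c2).intervalIntegrable _ _) fun r _ => ?_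
        have hw : (0:ℝ) < r ^ 2 + 1 := by positivity
        set w := r ^ 2 + 1
        have e1 : (pD2 u t r) ^ 2 * w ^ 2 ≤ en u t r := by
          change _ ≤ ((pD2 u t r) ^ 2 + (pD1 u t r) ^ 2) * w ^ 2
          have : 0 ≤ (pD1 u t r) ^ 2 * w ^ 2 := by positivity
          nlinarith
        have e2 : |pD2 u t r| ≤ η / 2 * ((pD2 u t r) ^ 2 * w ^ 2) + η⁻¹ / 2 * (w ^ 2)⁻¹ := by
          rw [← sq_abs (pD2 u t r)]
          set p := |pD2 u t r|
          have : η / 2 * (p ^ 2 * w ^ 2) + η⁻¹ / 2 * (w ^ 2)⁻¹ - p = (η * p * w ^ 2 - 1) ^ 2 / (2 * η * w ^ 2) := by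
            field_simp
            ring
          have h3 : 0 ≤ (η * p * w ^ 2 - 1) ^ 2 / (2 * η * w ^ 2) := by positivity
          linarith
        nlinarith
    _ = _ := by
        rw [intervalIntegral.integral_add (c1.intervalIntegrable _ _) (c2.intervalIntegrable _ _),
          intervalIntegral.integral_const_mul, intervalIntegral.integral_const_mul]
        ring

theorem w_int_bdd (a b : ℝ) (hab : a ≤ b) : ∫ r in a..b, ((r ^ 2 + 1 : ℝ) ^ 2)⁻¹ ≤ 4 := by
  have c2 : Continuous (fun r : ℝ => ((r ^ 2 + 1) ^ 2)⁻¹) :=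
    Continuous.inv₀ (by fun_prop) fun r => by positivity
  have c3 : Continuous (fun r : ℝ => (1 + r ^ 2)⁻¹) :=
    Continuous.inv₀ (by fun_prop) fun r => by positivity
  calc _ ≤ ∫ r in a..b, (1 + r ^ 2 : ℝ)⁻¹ := by
        refine intervalIntegral.integral_mono_on hab (c2.intervalIntegrable _ _)
          (c3.intervalIntegrable _ _) fun r _ => ?_
        apply inv_anti₀ (by positivity)
        nlinarith [sq_nonneg r]
    _ = arctan b - arctan a := integral_inv_one_add_sq
    _ ≤ 4 := by
        linarith [arctan_lt_pi_div_two b, neg_pi_div_two_lt_arctan a, Real.pi_lt_four]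

theorem w_int_tail (a b : ℝ) (ha : 1 ≤ a) (hab : a ≤ b) :
    ∫ r in a..b, ((r ^ 2 + 1 : ℝ) ^ 2)⁻¹ ≤ (a ^ 3)⁻¹ := by
  have c2 : Continuous (fun r : ℝ => ((r ^ 2 + 1) ^ 2)⁻¹) :=
    Continuous.inv₀ (by fun_prop) fun r => by positivity
  have c3 : ContinuousOn (fun r : ℝ => (r ^ 4)⁻¹) (Set.uIcc a b) := by
    rw [Set.uIcc_of_le hab]
    refine ContinuousOn.inv₀ (by fun_prop) fun r hr => ?_
    have : 0 < r := by linarith [hr.1]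
    positivity
  have hF : ∫ r in a..b, (r ^ 4)⁻¹ = (-(b ^ 3)⁻¹ / 3) - (-(a ^ 3)⁻¹ / 3) := by
    refine intervalIntegral.integral_eq_sub_of_hasDerivAt (f := fun r => -(r ^ 3)⁻¹ / 3)
      (fun r hr => ?_) c3.intervalIntegrable
    rw [Set.uIcc_of_le hab] at hr
    have h0 : r ≠ 0 := by linarith [hr.1]
    have := ((hasDerivAt_pow 3 r).inv (pow_ne_zero 3 h0)).neg.div_const 3
    refine this.congr_deriv ?_
    field_simp
    push_cast; ring
  calc _ ≤ ∫ r in a..b, (r ^ 4 : ℝ)⁻¹ := by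
        refine intervalIntegral.integral_mono_on hab (c2.intervalIntegrable _ _)
          c3.intervalIntegrable fun r hr => ?_
        have : 0 < r := by linarith [hr.1]
        apply inv_anti₀ (by positivity)
        nlinarith [sq_nonneg r]
    _ ≤ _ := by
        rw [hF]
        have h1 : 0 ≤ (b ^ 3)⁻¹ := by have : 0 < b := by linarith
                                      positivity
        have h2 : 0 ≤ (a ^ 3)⁻¹ := by positivity
        linarith

theorem u_osc {u : ℝ → ℝ → ℝ} (h : PC 1 u) (B : ℝ)
    (hB : ∀ t a b, a ≤ b → ∫ r in a..b, en u t r ≤ B) (t a b : ℝ) :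
    |u t b - u t a| ≤ B / 2 + 2 := by
  wlog hab : a ≤ b generalizing a b
  · rw [abs_sub_comm]; exact this b a (by linarith)
  have h1 := osc h t a b hab 1 one_pos
  have h2 := hB t a b hab
  have h3 := w_int_bdd a b hab
  simp only [inv_one, one_mul] at h1
  linarith

theorem u_limit {u : ℝ → ℝ → ℝ} (h : PC 1 u) (B : ℝ) (hB0 : 0 ≤ B)
    (hB : ∀ t a b, a ≤ b → ∫ r in a..b, en u t r ≤ B) :
    ∃ (C : ℝ) (c : ℝ → ℝ), 0 ≤ C ∧ ∀ t r, 1 ≤ r → |u t r - c t| ≤ C * r ^ (-(3/2) : ℝ) := by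
  have key : ∀ t a b, 1 ≤ a → a ≤ b → |u t b - u t a| ≤ (B + 1) * a ^ (-(3/2) : ℝ) := by
    intro t a b ha hab
    have ha0 : 0 < a := by linarith
    have hη : 0 < a ^ (-(3/2) : ℝ) := rpow_pos_of_pos ha0 _
    have h1 := osc h t a b hab _ hη
    have h2 := hB t a b hab
    have h3 := w_int_tail a b ha hab
    set η := a ^ (-(3/2) : ℝ) with hh
    have h4 : (a ^ 3)⁻¹ = η ^ 2 := by
      rw [hh, ← rpow_natCast, ← rpow_natCast, ← rpow_mul ha0.le, ← rpow_neg ha0.le]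
      norm_num
    rw [h4] at h3
    have h5 : η⁻¹ * (∫ r in a..b, ((r ^ 2 + 1 : ℝ) ^ 2)⁻¹) ≤ η⁻¹ * η ^ 2 :=
      mul_le_mul_of_nonneg_left h3 (by positivity)
    have h6 : η⁻¹ * η ^ 2 = η := by field_simp
    have h7 : η * (∫ r in a..b, en u t r) ≤ η * B := mul_le_mul_of_nonneg_left h2 hη.le
    nlinarith
  have hz : Tendsto (fun a : ℝ => (B + 1) * a ^ (-(3/2) : ℝ)) atTop (nhds 0) := by
    simpa using (tendsto_rpow_neg_atTop (by norm_num : (0:ℝ) < 3/2)).const_mul (B + 1)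
  have hlim : ∀ t, ∃ c, Tendsto (u t) atTop (nhds c) := by
    intro t
    refine cauchySeq_tendsto_of_complete ?_
    rw [Metric.cauchySeq_iff']
    intro ε hε
    obtain ⟨a, ha, ha1⟩ := ((hz.eventually (gt_mem_nhds hε)).and (eventually_ge_atTop 1)).exists
    exact ⟨a, fun b hb => by rw [Real.dist_eq]; exact (key t a b ha1 hb).trans_lt ha⟩
  choose c hc using hlim
  refine ⟨B + 1, c, by linarith, fun t r hr => ?_⟩
  rw [abs_sub_comm]
  exact le_of_tendsto ((hc t).sub_const (u t r)).abs
    (by filter_upwards [eventually_ge_atTop r] with b hb using key t r b hr hb)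

noncomputable def vv (u : ℝ → ℝ → ℝ) (t r : ℝ) : ℝ := (r ^ 2 + 1) * u t r

theorem vv_PC {u : ℝ → ℝ → ℝ} {n : WithTop ℕ∞} (h : PC n u) : PC n (vv u) := by
  unfold PC vv
  have h' : ContDiff ℝ n (fun p : ℝ × ℝ => u p.1 p.2) := h
  have : ContDiff ℝ n (fun p : ℝ × ℝ => p.2 ^ 2 + 1) := by fun_prop
  exact this.mul h'

theorem vv_D1 {u : ℝ → ℝ → ℝ} (h : PC 1 u) : pD1 (vv u) = vv (pD1 u) := by
  funext t r
  exact ((pD1_hasDerivAt h t r).const_mul (r ^ 2 + 1)).deriv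

theorem sq1_deriv (r : ℝ) : HasDerivAt (fun x : ℝ => x ^ 2 + 1) (2 * r) r := by
  simpa using (hasDerivAt_pow 2 r).add_const 1

theorem vv_D2 {u : ℝ → ℝ → ℝ} (h : PC 1 u) (t r : ℝ) :
    pD2 (vv u) t r = 2 * r * u t r + (r ^ 2 + 1) * pD2 u t r :=
  ((sq1_deriv r).mul (pD2_hasDerivAt h t r)).deriv

theorem vv_D22 {u : ℝ → ℝ → ℝ} (h : PC 2 u) (t r : ℝ) :
    pD2 (pD2 (vv u)) t r = 2 * u t r + 4 * r * pD2 u t r + (r ^ 2 + 1) * pD2 (pD2 u) t r := by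
  have e : pD2 (vv u) t = fun r => 2 * r * u t r + (r ^ 2 + 1) * pD2 u t r := by
    funext r; exact vv_D2 h.one t r
  change deriv (pD2 (vv u) t) r = _
  rw [e]
  have h1 : HasDerivAt (fun x : ℝ => 2 * x) 2 r := by simpa using (hasDerivAt_id r).const_mul 2
  have := (h1.mul (pD2_hasDerivAt h.one t r)).add ((sq1_deriv r).mul (pD2_hasDerivAt (pD2_C h) t r))
  refine (this.congr_deriv ?_).deriv
  ring

theorem vv_eq {Q : ℝ → ℝ} {u : ℝ → ℝ → ℝ} (hu : SolvesReduced Q u) (t r : ℝ) :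
    pD1 (pD1 (vv u)) t r - pD2 (pD2 (vv u)) t r = - (u t r / (r ^ 2 + 1)) +
      (sin (2 * Q r) - sin (2 * Q r + 2 * (sqrt (r ^ 2 + 1) * u t r))) / sqrt (r ^ 2 + 1) := by
  have h : PC 2 u := hu.1
  rw [vv_D22 h, vv_D1 h.one, vv_D1 (pD1_C h)]
  have e := hu.2 t r
  change pD1 (pD1 u) t r - pD2 (pD2 u) t r - (4 * r / (r ^ 2 + 1)) * pD2 u t r
    + Vpot Q r * u t r = Npot Q r (u t r) at e
  unfold vv
  have e2 : pD1 (pD1 u) t r = pD2 (pD2 u) t r + (4 * r / (r ^ 2 + 1)) * pD2 u t r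
    - Vpot Q r * u t r + Npot Q r (u t r) := by linarith
  rw [e2]
  unfold Vpot Npot
  have hs : 0 < sqrt (r ^ 2 + 1) := sqrt_pos.2 (by positivity)
  have hs2 : r ^ 2 + 1 = sqrt (r ^ 2 + 1) ^ 2 := (sq_sqrt (by positivity)).symm
  set s := sqrt (r ^ 2 + 1)
  rw [hs2, sin_add, show 2 * (s * u t r) = 2 * s * u t r by ring]
  have hc : cos (2 * s * u t r) = 1 - 2 * sin (s * u t r) ^ 2 := by
    rw [show 2 * s * u t r = 2 * (s * u t r) by ring, cos_two_mul, cos_sq']; ring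
  rw [hc]
  field_simp
  ring

theorem phi_int (R : ℝ) : ∫ r in R..(2 * R), (r - R) * (2 * R - r) = R ^ 3 / 6 := by
  have : ∀ r ∈ Set.uIcc R (2 * R), HasDerivAt (fun r => -r ^ 3 / 3 + 3 * R * r ^ 2 / 2 - 2 * R ^ 2 * r)
      ((r - R) * (2 * R - r)) r := by
    intro r _
    have := (((hasDerivAt_pow 3 r).neg.div_const 3).add
      (((hasDerivAt_pow 2 r).const_mul (3 * R)).div_const 2)).sub ((hasDerivAt_id r).const_mul (2 * R ^ 2))
    refine this.congr_deriv ?_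
    push_cast; ring
  rw [intervalIntegral.integral_eq_sub_of_hasDerivAt this
    (Continuous.intervalIntegrable (by fun_prop) _ _)]
  ring

theorem phi_bound {g : ℝ → ℝ} (hg : Continuous g) {R M : ℝ} (hR : 0 ≤ R)
    (h : ∀ r, R ≤ r → r ≤ 2 * R → |g r| ≤ M) :
    |∫ r in R..(2 * R), (r - R) * (2 * R - r) * g r| ≤ M * R ^ 3 / 6 := by
  have hR2 : R ≤ 2 * R := by linarith
  calc _ ≤ ∫ r in R..(2 * R), |(r - R) * (2 * R - r) * g r| :=
        intervalIntegral.abs_integral_le_integral_abs hR2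
    _ ≤ ∫ r in R..(2 * R), M * ((r - R) * (2 * R - r)) := by
        refine intervalIntegral.integral_mono_on hR2
          (Continuous.intervalIntegrable (by fun_prop) _ _)
          (Continuous.intervalIntegrable (by fun_prop) _ _) fun r hr => ?_
        have hp : 0 ≤ (r - R) * (2 * R - r) :=
          mul_nonneg (by linarith [hr.1]) (by linarith [hr.2])
        rw [abs_mul, abs_of_nonneg hp]
        nlinarith [h r hr.1 hr.2]
    _ = _ := by rw [intervalIntegral.integral_const_mul, phi_int]; ring

theorem phi_parts {y y' y'' : ℝ → ℝ} (h1 : ∀ r, HasDerivAt y (y' r) r)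
    (h2 : ∀ r, HasDerivAt y' (y'' r) r) (hc : Continuous y'') {R M : ℝ} (hR : 0 ≤ R)
    (h : ∀ r, R ≤ r → r ≤ 2 * R → |y r| ≤ M) :
    |∫ r in R..(2 * R), (r - R) * (2 * R - r) * y'' r| ≤ 4 * R * M := by
  have hR2 : R ≤ 2 * R := by linarith
  have hy : Continuous y := continuous_iff_continuousAt.2 fun r => (h1 r).continuousAt
  have c1 : Continuous (fun r => (r - R) * (2 * R - r) * y'' r) := by fun_prop
  have c2 : Continuous (fun r => 2 * y r) := by fun_prop
  have hF : ∫ r in R..(2 * R), ((r - R) * (2 * R - r) * y'' r + 2 * y r)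
      = ((2 * R - R) * (2 * R - 2 * R) * y' (2 * R) - (3 * R - 2 * (2 * R)) * y (2 * R))
        - ((R - R) * (2 * R - R) * y' R - (3 * R - 2 * R) * y R) := by
    refine intervalIntegral.integral_eq_sub_of_hasDerivAt
      (f := fun r => (r - R) * (2 * R - r) * y' r - (3 * R - 2 * r) * y r) (fun r _ => ?_)
      ((c1.add c2).intervalIntegrable _ _)
    have := ((((hasDerivAt_id r).sub_const R).mul ((hasDerivAt_id r).const_sub (2 * R))).mul (h2 r)).sub
      ((((hasDerivAt_id r).const_mul 2).const_sub (3 * R)).mul (h1 r))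
    refine this.congr_deriv ?_
    simp only [id, Pi.mul_apply]; ring
  rw [intervalIntegral.integral_add (c1.intervalIntegrable _ _) (c2.intervalIntegrable _ _)] at hF
  have hb : |∫ r in R..(2 * R), 2 * y r| ≤ 2 * M * |2 * R - R| := by
    rw [← Real.norm_eq_abs]
    refine intervalIntegral.norm_integral_le_of_norm_le_const fun r hr => ?_
    rw [Set.uIoc_of_le hR2] at hr
    rw [Real.norm_eq_abs, abs_mul, abs_two]
    linarith [h r hr.1.le hr.2]
  rw [show 2 * R - R = R by ring, abs_of_nonneg hR] at hb
  have e : ∫ r in R..(2 * R), (r - R) * (2 * R - r) * y'' r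
      = R * y (2 * R) + R * y R - ∫ r in R..(2 * R), 2 * y r := by linarith
  rw [e]
  have b1 := abs_le.1 (h (2 * R) hR2 le_rfl)
  have b2 := abs_le.1 (h R le_rfl hR2)
  have b3 := abs_le.1 hb
  rw [abs_le]
  constructor <;> nlinarith

noncomputable def mom (W : ℝ → ℝ → ℝ) (R t : ℝ) : ℝ :=
  ∫ r in R..(2 * R), (r - R) * (2 * R - r) * W t r

theorem mom_deriv {W : ℝ → ℝ → ℝ} (h : PC 1 W) (R t : ℝ) :
    HasDerivAt (fun t => mom W R t) (mom (pD1 W) R t) t := by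
  have h1 := pD1_cont h
  have h0 := h.cont
  unfold mom
  refine hasDerivAt_param (K := fun t r => (r - R) * (2 * R - r) * W t r)
    (K' := fun t r => (r - R) * (2 * R - r) * pD1 W t r) R (2 * R) t ?_ ?_ ?_
  · exact Continuous.mul (by fun_prop) h0
  · exact Continuous.mul (by fun_prop) h1
  · intro t r
    exact (pD1_hasDerivAt h t r).const_mul _

theorem rpow_m32 {r : ℝ} (hr : 1 ≤ r) : r ^ (-(3/2) : ℝ) = sqrt r / r ^ 2 := by
  have h0 : 0 < r := by linarith
  rw [sqrt_eq_rpow, ← rpow_natCast, ← rpow_sub h0]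
  norm_num

theorem rpow_m32_le {r : ℝ} (hr : 1 ≤ r) : (r ^ 2 + 1) * r ^ (-(3/2) : ℝ) ≤ 2 * sqrt r := by
  rw [rpow_m32 hr]
  have h0 : 0 < r := by linarith
  have hs : 0 ≤ sqrt r := sqrt_nonneg r
  rw [mul_div_assoc', div_le_iff₀ (by positivity)]
  nlinarith [mul_nonneg hs (by nlinarith : (0:ℝ) ≤ r ^ 2 - 1)]

theorem rpow_m32_one {r : ℝ} (hr : 1 ≤ r) : r ^ (-(3/2) : ℝ) ≤ 1 :=
  rpow_le_one_of_one_le_of_nonpos hr (by norm_num)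

theorem sqrt_win {S r : ℝ} (hS : 1 ≤ S) (hr : r ≤ 2 * S ^ 2) : sqrt r ≤ 2 * S := by
  rw [show 2 * S = sqrt ((2 * S) ^ 2) from (sqrt_sq (by linarith)).symm]
  exact sqrt_le_sqrt (by nlinarith)

theorem mom_D1_bound {u : ℝ → ℝ → ℝ} (h : PC 1 u) {B : ℝ}
    (hB : ∀ t a b, a ≤ b → ∫ r in a..b, en u t r ≤ B) {S : ℝ} (hS : 1 ≤ S) (t : ℝ) :
    |mom (pD1 (vv u)) (S ^ 2) t| ≤ S ^ 5 * (B + 1) := by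
  set R := S ^ 2 with hR
  have hR0 : 0 ≤ R := by positivity
  have hR2 : R ≤ 2 * R := by linarith
  have hc : Continuous (fun r => pD1 (vv u) t r) :=
    (pD1_cont (vv_PC h)).comp (Continuous.prodMk_right t)
  have hec := en_cont h t
  unfold mom
  have c1 : Continuous (fun r => R ^ 2 / 8 * S * en u t r) := by fun_prop
  have c2 : Continuous (fun r : ℝ => R ^ 2 / 8 * S⁻¹) := by fun_prop
  calc _ ≤ ∫ r in R..(2 * R), |(r - R) * (2 * R - r) * pD1 (vv u) t r| :=
        intervalIntegral.abs_integral_le_integral_abs hR2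
    _ ≤ ∫ r in R..(2 * R), (R ^ 2 / 8 * S * en u t r + R ^ 2 / 8 * S⁻¹) := by
        refine intervalIntegral.integral_mono_on hR2
          (Continuous.intervalIntegrable (by fun_prop) _ _)
          (Continuous.intervalIntegrable (by fun_prop) _ _) fun r hr => ?_
        have hp : 0 ≤ (r - R) * (2 * R - r) :=
          mul_nonneg (by linarith [hr.1]) (by linarith [hr.2])
        have hp2 : (r - R) * (2 * R - r) ≤ R ^ 2 / 4 := by nlinarith [sq_nonneg (2 * r - 3 * R)]
        rw [abs_mul, abs_of_nonneg hp]
        have e1 : |pD1 (vv u) t r| ^ 2 ≤ en u t r := by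
          rw [vv_D1 h, sq_abs]
          unfold vv en
          have : 0 ≤ (pD2 u t r) ^ 2 * (r ^ 2 + 1) ^ 2 := by positivity
          nlinarith
        set p := |pD1 (vv u) t r|
        have hp0 : 0 ≤ p := abs_nonneg _
        have e2 : p ≤ S / 2 * p ^ 2 + S⁻¹ / 2 := by
          have : S / 2 * p ^ 2 + S⁻¹ / 2 - p = (S * p - 1) ^ 2 / (2 * S) := by
            field_simp
            ring
          have h3 : 0 ≤ (S * p - 1) ^ 2 / (2 * S) := by positivity
          linarith
        have e3 : p ≤ S / 2 * en u t r + S⁻¹ / 2 := by nlinarith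
        calc (r - R) * (2 * R - r) * p ≤ R ^ 2 / 4 * p := by gcongr
          _ ≤ R ^ 2 / 4 * (S / 2 * en u t r + S⁻¹ / 2) := by gcongr
          _ = _ := by ring
    _ = R ^ 2 / 8 * S * (∫ r in R..(2 * R), en u t r) + R * (R ^ 2 / 8 * S⁻¹) := by
        rw [intervalIntegral.integral_add (c1.intervalIntegrable _ _) (c2.intervalIntegrable _ _),
          intervalIntegral.integral_const_mul, intervalIntegral.integral_const, smul_eq_mul]
        ring
    _ ≤ R ^ 2 / 8 * S * B + R * (R ^ 2 / 8 * S⁻¹) := by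
        gcongr
        exact hB t _ _ hR2
    _ = S ^ 5 * (B + 1) / 8 := by rw [hR]; field_simp
    _ ≤ S ^ 5 * (B + 1) := by
        have hB0 : 0 ≤ B := by have := hB 0 0 0 le_rfl; simpa using this
        have : 0 ≤ S ^ 5 * (B + 1) := by positivity
        linarith

theorem vv_src {Q : ℝ → ℝ} {u : ℝ → ℝ → ℝ} (hu : SolvesReduced Q u) (t r : ℝ) (hr : 1 ≤ r) :
    |pD1 (pD1 (vv u)) t r - pD2 (pD2 (vv u)) t r| ≤ (|u t r| + 2) / r := by
  rw [vv_eq hu]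
  have h0 : 0 < r := by linarith
  have hs : r ≤ sqrt (r ^ 2 + 1) := by
    calc r = sqrt (r ^ 2) := (sqrt_sq h0.le).symm
      _ ≤ _ := sqrt_le_sqrt (by linarith)
  have hs0 : 0 < sqrt (r ^ 2 + 1) := by linarith
  have e1 : |-(u t r / (r ^ 2 + 1))| ≤ |u t r| / r := by
    rw [abs_neg, abs_div, abs_of_pos (by positivity : (0:ℝ) < r ^ 2 + 1)]
    exact div_le_div_of_nonneg_left (abs_nonneg _) h0 (by nlinarith)
  have e2 : |(sin (2 * Q r) - sin (2 * Q r + 2 * (sqrt (r ^ 2 + 1) * u t r))) / sqrt (r ^ 2 + 1)|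
      ≤ 2 / r := by
    rw [abs_div, abs_of_pos hs0]
    refine div_le_div₀ (by norm_num) ?_ h0 hs
    have := abs_sub (sin (2 * Q r)) (sin (2 * Q r + 2 * (sqrt (r ^ 2 + 1) * u t r)))
    linarith [abs_sin_le_one (2 * Q r), abs_sin_le_one (2 * Q r + 2 * (sqrt (r ^ 2 + 1) * u t r))]
  rw [add_div]
  exact (abs_add_le _ _).trans (add_le_add e1 e2)

theorem vv_src2 {Q : ℝ → ℝ} {u : ℝ → ℝ → ℝ} (hu : SolvesReduced Q u) (t r : ℝ) :
    |pD1 (pD1 (vv u)) t r - pD2 (pD2 (vv u)) t r| ≤ 3 * |u t r| := by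
  rw [vv_eq hu]
  have hs0 : 0 < sqrt (r ^ 2 + 1) := sqrt_pos.2 (by positivity)
  have e1 : |-(u t r / (r ^ 2 + 1))| ≤ |u t r| := by
    rw [abs_neg, abs_div, abs_of_pos (by positivity : (0:ℝ) < r ^ 2 + 1)]
    exact div_le_self (abs_nonneg _) (by nlinarith)
  have e2 : |(sin (2 * Q r) - sin (2 * Q r + 2 * (sqrt (r ^ 2 + 1) * u t r))) / sqrt (r ^ 2 + 1)|
      ≤ 2 * |u t r| := by
    rw [abs_div, abs_of_pos hs0, div_le_iff₀ hs0]
    refine (abs_sin_sub_sin_le _ _).trans ?_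
    rw [sub_add_cancel_left, abs_neg, abs_mul, abs_two, abs_mul, abs_of_pos hs0]
    linarith
  linarith [abs_add_le (-(u t r / (r ^ 2 + 1))) ((sin (2 * Q r) - sin (2 * Q r + 2 * (sqrt (r ^ 2 + 1) * u t r))) / sqrt (r ^ 2 + 1))]

theorem mom_D11 {Q : ℝ → ℝ} {u : ℝ → ℝ → ℝ} (hu : SolvesReduced Q u)
    {C : ℝ} (hC : 0 ≤ C) (t c : ℝ)
    (hlim : ∀ r, 1 ≤ r → |u t r - c| ≤ C * r ^ (-(3/2) : ℝ)) {S : ℝ} (hS : 1 ≤ S) :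
    |mom (pD1 (pD1 (vv u))) (S ^ 2) t - c * S ^ 6 / 3| ≤ (17 * C + |c| + 2) * S ^ 4 := by
  have h : PC 2 u := hu.1
  have hv := vv_PC h
  set R := S ^ 2 with hR
  have hR1 : 1 ≤ R := one_le_pow₀ hS
  have hR0 : 0 ≤ R := by linarith
  have hc2 : Continuous (fun r => pD2 (pD2 (vv u)) t r) :=
    (pD2_cont (pD2_C hv)).comp (Continuous.prodMk_right t)
  have hc1 : Continuous (fun r => pD1 (pD1 (vv u)) t r) :=
    (pD1_cont (pD1_C hv)).comp (Continuous.prodMk_right t)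
  have k1 : |∫ r in R..(2 * R), (r - R) * (2 * R - r) * (pD2 (pD2 (vv u)) t r - c * 2)|
      ≤ 4 * R * (4 * C * S) := by
    refine phi_parts (y := fun r => vv u t r - c * (r ^ 2 + 1))
      (y' := fun r => pD2 (vv u) t r - c * (2 * r)) (fun r => ?_) (fun r => ?_) (by fun_prop) hR0
      fun r h1 h2 => ?_
    · exact (pD2_hasDerivAt hv.one t r).sub ((sq1_deriv r).const_mul c)
    · have h1 : HasDerivAt (fun x : ℝ => c * (2 * x)) (c * 2) r := by
        simpa using ((hasDerivAt_id r).const_mul 2).const_mul c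
      exact (pD2_hasDerivAt (pD2_C hv) t r).sub h1
    · have hr1 : 1 ≤ r := by linarith
      unfold vv
      rw [show (r ^ 2 + 1) * u t r - c * (r ^ 2 + 1) = (r ^ 2 + 1) * (u t r - c) by ring, abs_mul,
        abs_of_pos (by positivity : (0:ℝ) < r ^ 2 + 1)]
      calc (r ^ 2 + 1) * |u t r - c| ≤ (r ^ 2 + 1) * (C * r ^ (-(3/2) : ℝ)) := by
            gcongr; exact hlim r hr1
        _ = C * ((r ^ 2 + 1) * r ^ (-(3/2) : ℝ)) := by ring
        _ ≤ C * (2 * sqrt r) := mul_le_mul_of_nonneg_left (rpow_m32_le hr1) hC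
        _ ≤ C * (2 * (2 * S)) := by gcongr; exact sqrt_win hS h2
        _ = _ := by ring
  have k2 : |∫ r in R..(2 * R), (r - R) * (2 * R - r) *
      (pD1 (pD1 (vv u)) t r - pD2 (pD2 (vv u)) t r)| ≤ ((|c| + C + 2) / R) * R ^ 3 / 6 := by
    refine phi_bound (by fun_prop) hR0 fun r h1 h2 => ?_
    have hr1 : 1 ≤ r := by linarith
    refine (vv_src hu t r hr1).trans (div_le_div₀ (by positivity) ?_ (by linarith) h1)
    have e1 := hlim r hr1
    have e2 : C * r ^ (-(3/2) : ℝ) ≤ C * 1 := by gcongr; exact rpow_m32_one hr1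
    have e3 : |u t r| ≤ |u t r - c| + |c| := by
      have := abs_add_le (u t r - c) c
      simpa using this
    linarith
  have k3 : mom (pD1 (pD1 (vv u))) R t
      = (∫ r in R..(2 * R), (r - R) * (2 * R - r) * (pD2 (pD2 (vv u)) t r - c * 2))
        + (∫ r in R..(2 * R), (r - R) * (2 * R - r) *
      (pD1 (pD1 (vv u)) t r - pD2 (pD2 (vv u)) t r)) + c * R ^ 3 / 3 := by
    have e : c * R ^ 3 / 3 = ∫ r in R..(2 * R), 2 * c * ((r - R) * (2 * R - r)) := by
      rw [intervalIntegral.integral_const_mul, phi_int]; ring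
    unfold mom
    rw [e, ← intervalIntegral.integral_add, ← intervalIntegral.integral_add]
    · congr 1; funext r; ring
    all_goals exact Continuous.intervalIntegrable (by fun_prop) _ _
  have hR3 : R ^ 3 = S ^ 6 := by rw [hR]; ring
  rw [k3, hR3]
  have e4 : ((|c| + C + 2) / R) * R ^ 3 / 6 = (|c| + C + 2) * S ^ 4 / 6 := by
    rw [hR]; field_simp
  rw [e4] at k2
  have e5 : 4 * R * (4 * C * S) ≤ 16 * C * S ^ 4 := by
    rw [hR]
    have : C * S ^ 3 ≤ C * S ^ 4 := by gcongr; norm_num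
    nlinarith
  have e6 : 0 ≤ (|c| + C + 2) * S ^ 4 := by positivity
  set I1 := ∫ r in R..(2 * R), (r - R) * (2 * R - r) * (pD2 (pD2 (vv u)) t r - c * 2)
  set I2 := ∫ r in R..(2 * R), (r - R) * (2 * R - r) * (pD1 (pD1 (vv u)) t r - pD2 (pD2 (vv u)) t r)
  have := abs_add_le I1 I2
  rw [add_sub_cancel_right]
  nlinarith

theorem c_zero {Q : ℝ → ℝ} {u : ℝ → ℝ → ℝ} (hu : SolvesReduced Q u) {B : ℝ}
    (hB : ∀ t a b, a ≤ b → ∫ r in a..b, en u t r ≤ B)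
    {C : ℝ} (hC : 0 ≤ C) {c : ℝ → ℝ}
    (hlim : ∀ t r, 1 ≤ r → |u t r - c t| ≤ C * r ^ (-(3/2) : ℝ)) (t0 : ℝ) : c t0 = 0 := by
  by_contra hne
  have h : PC 2 u := hu.1
  have hv := vv_PC h
  set c0 := c t0 with hc0
  have hcp : 0 < |c0| := abs_pos.2 hne
  have hz : Tendsto (fun a : ℝ => C * a ^ (-(3/2) : ℝ)) atTop (nhds 0) := by
    simpa using (tendsto_rpow_neg_atTop (by norm_num : (0:ℝ) < 3/2)).const_mul C
  obtain ⟨r0, hr0, hr1⟩ := ((hz.eventually (gt_mem_nhds (by positivity : 0 < |c0| / 8))).and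
    (eventually_ge_atTop 1)).exists
  have hcont : ContinuousAt (fun t => u t r0) t0 := (pD1_hasDerivAt h.one t0 r0).continuousAt
  obtain ⟨δ', hδ', hδ⟩ := Metric.continuousAt_iff.1 hcont (|c0| / 4) (by positivity)
  set δ := δ' / 2 with hδd
  have hδp : 0 < δ := by positivity
  have hcc : ∀ t, t0 ≤ t → t ≤ t0 + δ → |c t - c0| ≤ |c0| / 2 := by
    intro t h1 h2
    have e1 := hlim t r0 hr1
    have e2 := hlim t0 r0 hr1
    have e3 := hδ (x := t) (by rw [Real.dist_eq, abs_of_nonneg (by linarith)]; linarith)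
    rw [Real.dist_eq] at e3
    have e4 := (abs_le.1 (e1.trans hr0.le))
    have e5 := (abs_le.1 (e2.trans hr0.le))
    have e6 := (abs_lt.1 e3)
    rw [abs_le]
    constructor <;> linarith [e4.1, e4.2, e5.1, e5.2, e6.1, e6.2]
  set K := 17 * C + 3 * |c0| / 2 + 2 with hK
  have hB0 : 0 ≤ B := by have := hB 0 0 0 le_rfl; simpa using this
  have main : ∀ S, 1 ≤ S → δ * |c0| * S / 6 ≤ 2 * (B + 1) + δ * K := by
    intro S hS
    obtain ⟨ξ, hξ, hξe⟩ := exists_hasDerivAt_eq_slope (fun t => mom (pD1 (vv u)) (S ^ 2) t)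
      (fun t => mom (pD1 (pD1 (vv u))) (S ^ 2) t) (by linarith : t0 < t0 + δ)
      (fun x _ => (mom_deriv (pD1_C hv) (S ^ 2) x).continuousAt.continuousWithinAt)
      (fun x _ => mom_deriv (pD1_C hv) (S ^ 2) x)
    have e1 := mom_D11 hu hC ξ (c ξ) (hlim ξ) hS
    have e2 := hcc ξ hξ.1.le hξ.2.le
    have e3 := mom_D1_bound h.one hB hS t0
    have e4 := mom_D1_bound h.one hB hS (t0 + δ)
    rw [add_sub_cancel_left, eq_div_iff hδp.ne'] at hξe
    set m2 := mom (pD1 (pD1 (vv u))) (S ^ 2) ξ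
    have hS6 : (0:ℝ) < S ^ 6 := by positivity
    have e5 : |c ξ| ≤ 3 * |c0| / 2 := by
      have := abs_add_le (c ξ - c0) c0
      rw [sub_add_cancel] at this
      linarith
    have e6 : |m2 - c0 * S ^ 6 / 3| ≤ |c0| / 2 * S ^ 6 / 3 + K * S ^ 4 := by
      have : m2 - c0 * S ^ 6 / 3 = (m2 - c ξ * S ^ 6 / 3) + (c ξ - c0) * (S ^ 6 / 3) := by ring
      rw [this]
      refine (abs_add_le _ _).trans ?_
      rw [abs_mul (c ξ - c0), abs_of_pos (by positivity : 0 < S ^ 6 / 3)]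
      have a1 : |c ξ - c0| * (S ^ 6 / 3) ≤ |c0| / 2 * (S ^ 6 / 3) := by gcongr
      have a2 : (17 * C + |c ξ| + 2) * S ^ 4 ≤ K * S ^ 4 := by
        gcongr
        linarith
      linarith
    have e7 : |c0| * S ^ 6 / 3 ≤ |m2| + |m2 - c0 * S ^ 6 / 3| := by
      have : |c0 * S ^ 6 / 3| ≤ |m2| + |m2 - c0 * S ^ 6 / 3| := by
        have := abs_sub m2 (m2 - c0 * S ^ 6 / 3)
        rwa [sub_sub_cancel] at this
      rwa [abs_div, abs_mul, abs_of_pos hS6, abs_of_pos (by norm_num : (0:ℝ) < 3)] at this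
    have e8 : |m2| * δ ≤ 2 * (S ^ 5 * (B + 1)) := by
      have : |m2| * δ = |m2 * δ| := by rw [abs_mul, abs_of_pos hδp]
      rw [this, hξe]
      exact (abs_sub _ _).trans (by linarith)
    have e9 : δ * (|c0| * S ^ 6 / 6) ≤ 2 * (S ^ 5 * (B + 1)) + δ * (K * S ^ 4) := by
      nlinarith
    have e10 : δ * (K * S ^ 4) ≤ δ * (K * S ^ 5) := by
      have : 0 ≤ K := by positivity
      gcongr
      norm_num
    have hS5 : (0:ℝ) < S ^ 5 := by positivity
    have e11 : S ^ 5 * (δ * |c0| * S / 6) ≤ S ^ 5 * (2 * (B + 1) + δ * K) := by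
      calc _ = δ * (|c0| * S ^ 6 / 6) := by ring
        _ ≤ _ := e9.trans (by linarith)
    exact le_of_mul_le_mul_left e11 hS5
  set A := 2 * (B + 1) + δ * K with hA
  have hA0 : 0 ≤ A := by positivity
  have hm := main (1 + 6 * A / (δ * |c0|)) (by
    have : 0 ≤ 6 * A / (δ * |c0|) := by positivity
    linarith)
  have : δ * |c0| * (1 + 6 * A / (δ * |c0|)) / 6 = δ * |c0| / 6 + A := by
    field_simp
  rw [this] at hm
  have : 0 < δ * |c0| := by positivity
  linarith

theorem mono_ray {f f' : ℝ → ℝ} {R : ℝ} (hd : ∀ r, R ≤ r → HasDerivAt f (f' r) r)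
    (hn : ∀ r, R ≤ r → 0 ≤ f' r) (a b : ℝ) (ha : R ≤ a) (hab : a ≤ b) : f a ≤ f b := by
  refine monotoneOn_of_deriv_nonneg (convex_Ici R) (f := f)
    (fun r hr => (hd r hr).continuousAt.continuousWithinAt) ?_ ?_ ha (ha.trans hab) hab
  · intro r hr
    rw [interior_Ici] at hr
    exact (hd r (le_of_lt hr)).differentiableAt.differentiableWithinAt
  · intro r hr
    rw [interior_Ici] at hr
    rw [(hd r (le_of_lt hr)).deriv]
    exact hn r (le_of_lt hr)

theorem Q_decay {Q : ℝ → ℝ} (hQ : IsHarmonicMapSol Q) (n : ℕ)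
    (hQt : Tendsto Q atTop (nhds ((n : ℝ) * Real.pi))) :
    ∃ K R : ℝ, 0 ≤ K ∧ 1 ≤ R ∧ ∀ r, R ≤ r → |Q r - n * Real.pi| ≤ K / r := by
  set q : ℝ → ℝ := fun r => Q r - n * Real.pi with hq
  have hq0 : Tendsto q atTop (nhds 0) := by simpa [hq] using hQt.sub_const ((n : ℝ) * Real.pi)
  have hQ1 : ∀ r, HasDerivAt Q (deriv Q r) r :=
    fun r => (hQ.1.differentiable (by norm_num) r).hasDerivAt
  have hq1 : ∀ r, HasDerivAt q (deriv Q r) r := fun r => (hQ1 r).sub_const _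
  have hQ2 : ∀ r, HasDerivAt (deriv Q) (deriv (deriv Q) r) r := by
    have : ContDiff ℝ 1 (deriv Q) := by
      have h2 : ContDiff ℝ (1 + 1) Q := hQ.1
      exact (contDiff_succ_iff_deriv.1 h2).2.2
    exact fun r => (this.differentiable (by norm_num) r).hasDerivAt
  set k : ℝ → ℝ := fun r => (r ^ 2 + 1) * deriv Q r with hk
  have hk1 : ∀ r, HasDerivAt k (sin (2 * q r)) r := by
    intro r
    have h := (sq1_deriv r).mul (hQ2 r)
    refine h.congr_deriv ?_
    have e := hQ.2 r
    have es : sin (2 * q r) = sin (2 * Q r) := by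
      have : 2 * Q r = 2 * q r + n * (2 * Real.pi) := by simp only [hq]; ring
      rw [this, sin_add_nat_mul_two_pi]
    rw [es]
    have hw : (0:ℝ) < r ^ 2 + 1 := by positivity
    field_simp at e
    linarith
  have hev : ∀ᶠ r in atTop, |q r| < 1 := by
    have := hq0.abs
    rw [abs_zero] at this
    exact this.eventually (gt_mem_nhds one_pos)
  obtain ⟨R, hR⟩ := (hev.and (eventually_ge_atTop 1)).exists_forall_of_atTop
  have hsin : ∀ r, R ≤ r → 0 ≤ q r → 0 ≤ sin (2 * q r) := by
    intro r hr h0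
    have := abs_lt.1 (hR r hr).1
    exact sin_nonneg_of_nonneg_of_le_pi (by linarith) (by linarith [Real.pi_gt_three])
  have hsin' : ∀ r, R ≤ r → q r ≤ 0 → sin (2 * q r) ≤ 0 := by
    intro r hr h0
    have := abs_lt.1 (hR r hr).1
    exact sin_nonpos_of_nonpos_of_neg_pi_le (by linarith) (by linarith [Real.pi_gt_three])
  have hg : ∀ a b, R ≤ a → a ≤ b → q a * k a ≤ q b * k b := by
    refine mono_ray (f := fun r => q r * k r) (fun r _ => (hq1 r).mul (hk1 r)) fun r hr => ?_
    have h1 : 0 ≤ deriv Q r * k r := by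
      simp only [hk]
      have : deriv Q r * ((r ^ 2 + 1) * deriv Q r) = (r ^ 2 + 1) * deriv Q r ^ 2 := by ring
      rw [this]; positivity
    have h2 : 0 ≤ q r * sin (2 * q r) := by
      rcases le_total 0 (q r) with h0 | h0
      · exact mul_nonneg h0 (hsin r hr h0)
      · exact mul_nonneg_of_nonpos_of_nonpos h0 (hsin' r hr h0)
    linarith
  have hgn : ∀ r, R ≤ r → q r * k r ≤ 0 := by
    intro r1 hr1
    by_contra hpos
    push Not at hpos
    have hm : ∀ b, r1 ≤ b → q r1 * q r1 ≤ q b * q b := by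
      intro b hb
      refine mono_ray (f := fun r => q r * q r) (R := r1) (fun r _ => (hq1 r).mul (hq1 r))
        (fun r hr => ?_) r1 b le_rfl hb
      have h1 := hg r1 r hr1 hr
      have hw : (0:ℝ) < r ^ 2 + 1 := by positivity
      have h2 : 0 < (r ^ 2 + 1) * (q r * deriv Q r) := by
        have : (r ^ 2 + 1) * (q r * deriv Q r) = q r * k r := by simp only [hk]; ring
        linarith
      have h3 := pos_of_mul_pos_right h2 hw.le
      linarith
    have hl : Tendsto (fun r => q r * q r) atTop (nhds 0) := by simpa using hq0.mul hq0
    have : q r1 * q r1 ≤ 0 := ge_of_tendsto hl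
      (by filter_upwards [eventually_ge_atTop r1] with b hb using hm b hb)
    have hz : q r1 = 0 := by nlinarith [sq_nonneg (q r1)]
    rw [hz] at hpos
    simp at hpos
  have hk2 : ∀ a b, R ≤ a → a ≤ b → -(k a * k a) ≤ -(k b * k b) := by
    refine mono_ray (f := fun r => -(k r * k r)) (fun r _ => ((hk1 r).mul (hk1 r)).neg) fun r hr => ?_
    have h1 := hgn r hr
    have : k r * sin (2 * q r) ≤ 0 := by
      rcases lt_trichotomy (q r) 0 with h0 | h0 | h0
      · exact mul_nonpos_of_nonneg_of_nonpos (by nlinarith) (hsin' r hr h0.le)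
      · rw [h0]; simp
      · exact mul_nonpos_of_nonpos_of_nonneg (by nlinarith) (hsin r hr h0.le)
    linarith
  have hR1 : 1 ≤ R := (hR R le_rfl).2
  have hkb : ∀ r, R ≤ r → |k r| ≤ |k R| := by
    intro r hr
    have := hk2 R r le_rfl hr
    exact sq_le_sq.1 (by nlinarith)
  set K := |k R| with hK
  have hK0 : 0 ≤ K := abs_nonneg _
  have hq' : ∀ r, R ≤ r → |deriv Q r| ≤ K / r ^ 2 := by
    intro r hr
    have hr0 : 0 < r := by linarith
    rw [le_div_iff₀ (by positivity)]
    have h1 := hkb r hr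
    simp only [hk] at h1
    rw [abs_mul, abs_of_pos (by positivity : (0:ℝ) < r ^ 2 + 1)] at h1
    nlinarith [abs_nonneg (deriv Q r)]
  have hinv : ∀ r, R ≤ r → HasDerivAt (fun r : ℝ => K / r) (-(K / r ^ 2)) r := by
    intro r hr
    have hr0 : r ≠ 0 := by linarith
    have := (hasDerivAt_inv hr0).const_mul K
    refine this.congr_deriv ?_
    field_simp
  have hiz : Tendsto (fun r : ℝ => K / r) atTop (nhds 0) := tendsto_const_nhds.div_atTop tendsto_id
  refine ⟨K, R, hK0, hR1, fun r hr => ?_⟩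
  rw [abs_le]
  constructor
  · have h1 : ∀ b, r ≤ b → -(q r + K / r) ≤ -(q b + K / b) := by
      intro b hb
      refine mono_ray (f := fun r => -(q r + K / r)) (R := R)
        (fun r hr => ((hq1 r).add (hinv r hr)).neg) (fun r hr => ?_) r b hr hb
      have := abs_le.1 (hq' r hr)
      linarith
    have hl : Tendsto (fun r => -(q r + K / r)) atTop (nhds 0) := by simpa using (hq0.add hiz).neg
    have := ge_of_tendsto hl (by filter_upwards [eventually_ge_atTop r] with b hb using h1 b hb)
    linarith
  · have h1 : ∀ b, r ≤ b → (q r - K / r) ≤ (q b - K / b) := by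
      intro b hb
      refine mono_ray (f := fun r => (q r - K / r)) (R := R)
        (fun r hr => ((hq1 r).sub (hinv r hr))) (fun r hr => ?_) r b hr hb
      have := abs_le.1 (hq' r hr)
      linarith
    have hl : Tendsto (fun r => (q r - K / r)) atTop (nhds 0) := by simpa using (hq0.sub hiz)
    have := ge_of_tendsto hl (by filter_upwards [eventually_ge_atTop r] with b hb using h1 b hb)
    linarith

def shd (F : ℝ → ℝ → ℝ) (h t r : ℝ) : ℝ := F (t + h) r - F t r

theorem shd_PC {F : ℝ → ℝ → ℝ} {n : WithTop ℕ∞} (hF : PC n F) (h : ℝ) : PC n (shd F h) := by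
  have hF' : ContDiff ℝ n (fun p : ℝ × ℝ => F p.1 p.2) := hF
  have h1 : ContDiff ℝ n (fun p : ℝ × ℝ => (p.1 + h, p.2)) := by fun_prop
  exact (hF'.comp h1).sub hF'

theorem shd_D1 {F : ℝ → ℝ → ℝ} (hF : PC 1 F) (h : ℝ) : pD1 (shd F h) = shd (pD1 F) h := by
  funext t r
  exact (((pD1_hasDerivAt hF (t + h) r).comp_add_const t h).sub (pD1_hasDerivAt hF t r)).deriv

theorem shd_D2 {F : ℝ → ℝ → ℝ} (hF : PC 1 F) (h : ℝ) : pD2 (shd F h) = shd (pD2 F) h := by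
  funext t r
  exact ((pD2_hasDerivAt hF (t + h) r).sub (pD2_hasDerivAt hF t r)).deriv

theorem W_eq {Q : ℝ → ℝ} {u : ℝ → ℝ → ℝ} (hu : SolvesReduced Q u) (h t r : ℝ) :
    pD2 (pD2 (shd (vv u) h)) t r - pD1 (pD1 (shd (vv u) h)) t r
      = shd u h t r / (r ^ 2 + 1) +
      (sin (2 * Q r + 2 * (sqrt (r ^ 2 + 1) * u (t + h) r))
        - sin (2 * Q r + 2 * (sqrt (r ^ 2 + 1) * u t r))) / sqrt (r ^ 2 + 1) := by
  have hv := vv_PC (show PC 2 u from hu.1)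
  rw [shd_D2 hv.one, shd_D1 hv.one, shd_D2 (pD2_C hv), shd_D1 (pD1_C hv)]
  have e1 := vv_eq hu (t + h) r
  have e2 := vv_eq hu t r
  unfold shd
  have : pD2 (pD2 (vv u)) (t + h) r - pD2 (pD2 (vv u)) t r -
    (pD1 (pD1 (vv u)) (t + h) r - pD1 (pD1 (vv u)) t r)
    = -(pD1 (pD1 (vv u)) (t + h) r - pD2 (pD2 (vv u)) (t + h) r)
      + (pD1 (pD1 (vv u)) t r - pD2 (pD2 (vv u)) t r) := by ring
  rw [this, e1, e2]
  ring

theorem W_vv (u : ℝ → ℝ → ℝ) (h t r : ℝ) : shd (vv u) h t r = (r ^ 2 + 1) * shd u h t r := by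
  unfold shd vv; ring

theorem W_src {Q : ℝ → ℝ} {u : ℝ → ℝ → ℝ} (hu : SolvesReduced Q u) (h t r : ℝ) :
    |pD2 (pD2 (shd (vv u) h)) t r - pD1 (pD1 (shd (vv u) h)) t r| ≤ 3 * |shd (vv u) h t r| := by
  rw [W_eq hu, W_vv]
  have hs0 : 0 < sqrt (r ^ 2 + 1) := sqrt_pos.2 (by positivity)
  have hw : (0:ℝ) < r ^ 2 + 1 := by positivity
  have hw1 : (1:ℝ) ≤ r ^ 2 + 1 := by nlinarith
  have e1 : |shd u h t r / (r ^ 2 + 1)| ≤ |shd u h t r| := by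
    rw [abs_div, abs_of_pos hw]
    exact div_le_self (abs_nonneg _) hw1
  have e2 : |(sin (2 * Q r + 2 * (sqrt (r ^ 2 + 1) * u (t + h) r))
        - sin (2 * Q r + 2 * (sqrt (r ^ 2 + 1) * u t r))) / sqrt (r ^ 2 + 1)|
      ≤ 2 * |shd u h t r| := by
    rw [abs_div, abs_of_pos hs0, div_le_iff₀ hs0]
    refine (abs_sin_sub_sin_le _ _).trans ?_
    have : 2 * Q r + 2 * (sqrt (r ^ 2 + 1) * u (t + h) r) - (2 * Q r + 2 * (sqrt (r ^ 2 + 1) * u t r))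
      = 2 * (sqrt (r ^ 2 + 1) * shd u h t r) := by unfold shd; ring
    rw [this, abs_mul, abs_two, abs_mul, abs_of_pos hs0]
    linarith
  rw [abs_mul, abs_of_pos hw]
  have e3 := (abs_add_le _ _).trans (add_le_add e1 e2)
  nlinarith [abs_nonneg (shd u h t r)]

theorem sin_diff {a b m : ℝ} (ha : |a| ≤ m) (hb : |b| ≤ m) :
    |sin a - sin b - (a - b)| ≤ m ^ 2 / 2 * |a - b| := by
  have hd : ∀ x ∈ Set.Icc (-m) m, HasDerivWithinAt (fun x => sin x - x) (cos x - 1) (Set.Icc (-m) m) x :=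
    fun x _ => ((hasDerivAt_sin x).sub (hasDerivAt_id x)).hasDerivWithinAt
  have hbd : ∀ x ∈ Set.Icc (-m) m, ‖cos x - 1‖ ≤ m ^ 2 / 2 := by
    intro x hx
    rw [Real.norm_eq_abs, abs_sub_comm, abs_of_nonneg (by linarith [cos_le_one x])]
    have h1 := one_sub_sq_div_two_le_cos (x := x)
    have h2 : x ^ 2 ≤ m ^ 2 := sq_le_sq' hx.1 hx.2
    linarith
  have := (convex_Icc (-m) m).norm_image_sub_le_of_norm_hasDerivWithin_le hd hbd
    (abs_le.1 hb) (abs_le.1 ha)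
  rw [Real.norm_eq_abs, Real.norm_eq_abs] at this
  rwa [show sin a - sin b - (a - b) = sin a - a - (sin b - b) by ring]

theorem W_forc {Q : ℝ → ℝ} {u : ℝ → ℝ → ℝ} (hu : SolvesReduced Q u) (n : ℕ) {C K R : ℝ}
    (hC : 0 ≤ C) (hK : 0 ≤ K) (hR : 1 ≤ R)
    (hQ : ∀ r, R ≤ r → |Q r - n * Real.pi| ≤ K / r)
    (hb : ∀ t r, 1 ≤ r → |u t r| ≤ C * r ^ (-(3/2) : ℝ)) (h t r : ℝ) (hr : R ≤ r) :
    |forc (shd (vv u) h) t r| ≤ (3 + (2 * K + 4 * C) ^ 2) * |shd (vv u) h t r| * r ^ (-3 : ℝ) := by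
  have hr1 : 1 ≤ r := hR.trans hr
  have hr0 : 0 < r := by linarith
  have hs0 : 0 < sqrt (r ^ 2 + 1) := sqrt_pos.2 (by positivity)
  have hs1 : r ≤ sqrt (r ^ 2 + 1) := by
    calc r = sqrt (r ^ 2) := (sqrt_sq hr0.le).symm
      _ ≤ _ := sqrt_le_sqrt (by linarith)
  have hs2 : sqrt (r ^ 2 + 1) ≤ 2 * r := by
    rw [show 2 * r = sqrt ((2 * r) ^ 2) from (sqrt_sq (by linarith)).symm]
    exact sqrt_le_sqrt (by nlinarith)
  have hss : r ^ 2 + 1 = sqrt (r ^ 2 + 1) ^ 2 := (sq_sqrt (by positivity)).symm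
  have hq : 0 < sqrt r := sqrt_pos.2 hr0
  have hqq : sqrt r ^ 2 = r := sq_sqrt hr0.le
  have hq1 : 1 ≤ sqrt r := by rw [one_le_sqrt]; exact hr1
  have hQ' := hQ r hr
  set s := sqrt (r ^ 2 + 1) with hsd
  set p := sqrt r with hpd
  set m := (2 * K + 4 * C) / p with hm
  have hchi : ∀ t, |2 * (Q r - n * Real.pi) + 2 * (s * u t r)| ≤ m := by
    intro t
    have e1 := hb t r hr1
    rw [rpow_m32 hr1, ← hpd] at e1
    have e2 : s * |u t r| ≤ 2 * C / p := by
      calc s * |u t r| ≤ 2 * r * (C * (p / r ^ 2)) := by gcongr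
        _ = 2 * C / p := by
          rw [← hqq]; field_simp
    have e3 : K / r ≤ K / p := by
      apply div_le_div_of_nonneg_left hK hq
      nlinarith
    refine (abs_add_le _ _).trans ?_
    rw [abs_mul, abs_mul, abs_mul, abs_two, abs_of_pos hs0]
    have : m = 2 * (K / p) + 2 * (2 * C / p) := by rw [hm]; ring
    linarith
  have hshift : ∀ t, sin (2 * Q r + 2 * (s * u t r)) = sin (2 * (Q r - n * Real.pi) + 2 * (s * u t r)) := by
    intro t
    rw [← sin_add_nat_mul_two_pi (2 * (Q r - n * Real.pi) + 2 * (s * u t r)) n]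
    congr 1; ring
  have hE := sin_diff (hchi (t + h)) (hchi t)
  rw [← hshift, ← hshift] at hE
  have eab : 2 * (Q r - n * Real.pi) + 2 * (s * u (t + h) r) - (2 * (Q r - n * Real.pi) + 2 * (s * u t r))
      = 2 * s * shd u h t r := by unfold shd; ring
  rw [eab] at hE
  unfold forc
  rw [W_eq hu, W_vv, ← hsd]
  set D := shd u h t r
  set X := sin (2 * Q r + 2 * (s * u (t + h) r)) - sin (2 * Q r + 2 * (s * u t r))
  have hw : (0:ℝ) < r ^ 2 + 1 := by positivity
  have e1 : D / (r ^ 2 + 1) + X / s - 2 * ((r ^ 2 + 1) * D) / r ^ 2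
      = D / (r ^ 2 + 1) + (-(2 * D / r ^ 2)) + (X - 2 * s * D) / s := by
    field_simp
    ring
  have k1 : |D / (r ^ 2 + 1)| ≤ |D| / r := by
    rw [abs_div, abs_of_pos hw]
    exact div_le_div_of_nonneg_left (abs_nonneg _) hr0 (by nlinarith)
  have k2 : |-(2 * D / r ^ 2)| ≤ 2 * (|D| / r) := by
    rw [abs_neg, abs_div, abs_of_pos (by positivity : 0 < r ^ 2), abs_mul, abs_two, mul_div_assoc']
    exact div_le_div_of_nonneg_left (by positivity) hr0 (by nlinarith)
  have k3 : |(X - 2 * s * D) / s| ≤ (2 * K + 4 * C) ^ 2 * (|D| / r) := by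
    rw [abs_div, abs_of_pos hs0, div_le_iff₀ hs0]
    refine hE.trans (le_of_eq ?_)
    rw [abs_mul, abs_mul, abs_two, abs_of_pos hs0, hm, div_pow, hqq]
    ring
  have e2 : r ^ (-3 : ℝ) = 1 / r ^ 3 := by
    rw [rpow_neg hr0.le, ← one_div]; norm_num
  rw [e1, e2, abs_mul, abs_of_pos hw]
  have k4 := (abs_add_le (D / (r ^ 2 + 1) + (-(2 * D / r ^ 2))) ((X - 2 * s * D) / s)).trans
    (add_le_add ((abs_add_le _ _).trans (add_le_add k1 k2)) k3)
  refine k4.trans ?_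
  have k5 : |D| / r ≤ (r ^ 2 + 1) * |D| * (1 / r ^ 3) := by
    rw [mul_one_div, div_le_div_iff₀ hr0 (by positivity)]
    nlinarith [abs_nonneg D, mul_nonneg (abs_nonneg D) hr0.le]
  calc _ = (3 + (2 * K + 4 * C) ^ 2) * (|D| / r) := by ring
    _ ≤ (3 + (2 * K + 4 * C) ^ 2) * ((r ^ 2 + 1) * |D| * (1 / r ^ 3)) := by gcongr
    _ = _ := by ring

theorem W_bound {u : ℝ → ℝ → ℝ} {C : ℝ} (hC : 0 ≤ C)
    (hb : ∀ t r, 1 ≤ r → |u t r| ≤ C * r ^ (-(3/2) : ℝ)) (h t r : ℝ) (hr : 1 ≤ r) :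
    |shd (vv u) h t r| ≤ 4 * C * sqrt r := by
  have key : ∀ t, |vv u t r| ≤ 2 * C * sqrt r := by
    intro t
    unfold vv
    rw [abs_mul, abs_of_pos (by positivity : (0:ℝ) < r ^ 2 + 1)]
    calc (r ^ 2 + 1) * |u t r| ≤ (r ^ 2 + 1) * (C * r ^ (-(3/2) : ℝ)) := by
          gcongr; exact hb t r hr
      _ = C * ((r ^ 2 + 1) * r ^ (-(3/2) : ℝ)) := by ring
      _ ≤ C * (2 * sqrt r) := mul_le_mul_of_nonneg_left (rpow_m32_le hr) hC
      _ = _ := by ring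
  unfold shd
  have := abs_sub (vv u (t + h) r) (vv u t r)
  linarith [key t, key (t + h)]

noncomputable def Gf (u : ℝ → ℝ → ℝ) (t r : ℝ) : ℝ := |pD2 (vv u) t r| + |pD1 (vv u) t r|

theorem Gf_cont {u : ℝ → ℝ → ℝ} (h : PC 1 u) (t : ℝ) : Continuous (fun r => Gf u t r) := by
  have h1 : Continuous (fun r => pD1 (vv u) t r) :=
    (pD1_cont (vv_PC h)).comp (Continuous.prodMk_right t)
  have h2 : Continuous (fun r => pD2 (vv u) t r) :=
    (pD2_cont (vv_PC h)).comp (Continuous.prodMk_right t)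
  unfold Gf
  fun_prop

theorem Gf_win {u : ℝ → ℝ → ℝ} (h : PC 1 u) {C : ℝ} (hC : 0 ≤ C)
    (hb : ∀ t r, 1 ≤ r → |u t r| ≤ C * r ^ (-(3/2) : ℝ))
    (htail : ∀ ε, 0 < ε → ∃ R, 1 ≤ R ∧ ∀ t a b, R ≤ a → a ≤ b → ∫ r in a..b, en u t r ≤ ε)
    (ε : ℝ) (hε : 0 < ε) (r1 r2 : ℝ) (h1 : 1 ≤ r1) (h12 : r1 ≤ r2) :
    ∃ T0, 1 ≤ T0 ∧ ∀ T, T0 ≤ T → ∀ t, ∫ x in r1..r2, Gf u t (x + T) ≤ ε := by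
  set L := r2 - r1 with hL
  have hL0 : 0 ≤ L := by linarith
  set η := ε / (4 * (L + 1)) with hη
  have hη0 : 0 < η := by positivity
  obtain ⟨R, hR1, hR⟩ := htail (ε * η / 2) (by positivity)
  have hz : Tendsto (fun a : ℝ => 2 * C / sqrt a) atTop (nhds 0) :=
    tendsto_const_nhds.div_atTop tendsto_sqrt_atTop
  obtain ⟨T1, hT1⟩ := (hz.eventually (gt_mem_nhds hη0)).exists_forall_of_atTop
  refine ⟨max R T1, hR1.trans (le_max_left _ _), fun T hT t => ?_⟩
  have hTR : R ≤ T := (le_max_left _ _).trans hT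
  have hTT : T1 ≤ T := (le_max_right _ _).trans hT
  rw [intervalIntegral.integral_comp_add_right (fun x => Gf u t x)]
  have hle : r1 + T ≤ r2 + T := by linarith
  have hec := en_cont h t
  have c1 : Continuous (fun r => (2 * η)⁻¹ * en u t r) := by fun_prop
  have c2 : Continuous (fun r : ℝ => 2 * η) := by fun_prop
  calc ∫ x in (r1 + T)..(r2 + T), Gf u t x
      ≤ ∫ x in (r1 + T)..(r2 + T), ((2 * η)⁻¹ * en u t x + 2 * η) := by
        refine intervalIntegral.integral_mono_on hle ((Gf_cont h t).intervalIntegrable _ _)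
          ((c1.add c2).intervalIntegrable _ _) fun r hr => ?_
        have hrT : T1 ≤ r := by linarith [hr.1]
        have hr1 : 1 ≤ r := by linarith [hr.1]
        have hr0 : 0 < r := by linarith
        unfold Gf
        rw [vv_D2 h, vv_D1 h]
        unfold vv en
        have hw : (0:ℝ) < r ^ 2 + 1 := by positivity
        have e0 : |2 * r * u t r| ≤ η := by
          refine le_trans ?_ (hT1 r hrT).le
          have e1 := hb t r hr1
          rw [rpow_m32 hr1] at e1
          rw [abs_mul, abs_of_pos (by positivity : 0 < 2 * r)]
          have hq : 0 < sqrt r := sqrt_pos.2 hr0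
          have hqq : sqrt r ^ 2 = r := sq_sqrt hr0.le
          calc 2 * r * |u t r| ≤ 2 * r * (C * (sqrt r / r ^ 2)) := by gcongr
            _ = 2 * C / sqrt r := by
              set p := sqrt r
              rw [← hqq]; field_simp
        have e2 : ∀ p : ℝ, |p| ≤ η / 2 + (2 * η)⁻¹ * p ^ 2 := by
          intro p
          rw [← sq_abs p]
          have : η / 2 + (2 * η)⁻¹ * |p| ^ 2 - |p| = (|p| - η) ^ 2 / (2 * η) := by
            field_simp
            ring
          have h3 : 0 ≤ (|p| - η) ^ 2 / (2 * η) := by positivity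
          linarith
        have e3 := e2 ((r ^ 2 + 1) * pD2 u t r)
        have e4 := e2 ((r ^ 2 + 1) * pD1 u t r)
        have e5 := abs_add_le (2 * r * u t r) ((r ^ 2 + 1) * pD2 u t r)
        have e6 : (2 * η)⁻¹ * ((pD2 u t r ^ 2 + pD1 u t r ^ 2) * (r ^ 2 + 1) ^ 2)
          = (2 * η)⁻¹ * ((r ^ 2 + 1) * pD2 u t r) ^ 2 + (2 * η)⁻¹ * ((r ^ 2 + 1) * pD1 u t r) ^ 2 := by ring
        rw [e6]
        linarith
    _ = (2 * η)⁻¹ * (∫ x in (r1 + T)..(r2 + T), en u t x) + L * (2 * η) := by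
        rw [intervalIntegral.integral_add (c1.intervalIntegrable _ _) (c2.intervalIntegrable _ _),
          intervalIntegral.integral_const_mul, intervalIntegral.integral_const, smul_eq_mul]
        ring
    _ ≤ (2 * η)⁻¹ * (ε * η / 2) + L * (2 * η) := by
        gcongr
        exact hR t _ _ (by linarith) hle
    _ ≤ ε := by
        have a1 : (2 * η)⁻¹ * (ε * η / 2) = ε / 4 := by field_simp; norm_num
        have a2 : η * (4 * (L + 1)) = ε := by rw [hη]; field_simp
        nlinarith

theorem W_tail {u : ℝ → ℝ → ℝ} (hu : PC 2 u) {C : ℝ} (hC : 0 ≤ C)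
    (hb : ∀ t r, 1 ≤ r → |u t r| ≤ C * r ^ (-(3/2) : ℝ))
    (htail : ∀ ε, 0 < ε → ∃ R, 1 ≤ R ∧ ∀ t a b, R ≤ a → a ≤ b → ∫ r in a..b, en u t r ≤ ε)
    (h : ℝ) : TailHyp (shd (vv u) h) := by
  intro ε hε r1 r2 h1 h12
  obtain ⟨T0, hT0, hT⟩ := Gf_win hu.one hC hb htail (ε / 2) (by linarith) r1 r2 h1 h12
  have hz : Tendsto (fun a : ℝ => 4 * C / sqrt a) atTop (nhds 0) :=
    tendsto_const_nhds.div_atTop tendsto_sqrt_atTop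
  obtain ⟨T1, hT1⟩ := (hz.eventually (gt_mem_nhds hε)).exists_forall_of_atTop
  have hv := (vv_PC hu).one
  refine ⟨max T0 T1, hT0.trans (le_max_left _ _), fun t => ?_, fun t x hx => ?_⟩
  · set T := max T0 T1
    have k1 := hT T (le_max_left _ _) t
    have k2 := hT T (le_max_left _ _) (t + h)
    have c1 : Continuous (fun x => Gf u t (x + T)) := (Gf_cont hu.one t).comp (by fun_prop)
    have c2 : Continuous (fun x => Gf u (t + h) (x + T)) := (Gf_cont hu.one (t + h)).comp (by fun_prop)
    have g1 : Continuous (fun r => pD1 (shd (vv u) h) t r) :=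
      (pD1_cont (shd_PC hv h)).comp (Continuous.prodMk_right t)
    have g2 : Continuous (fun r => pD2 (shd (vv u) h) t r) :=
      (pD2_cont (shd_PC hv h)).comp (Continuous.prodMk_right t)
    calc _ ≤ ∫ x in r1..r2, (Gf u (t + h) (x + T) + Gf u t (x + T)) := by
          refine intervalIntegral.integral_mono_on h12
            (Continuous.intervalIntegrable ?_ _ _) ((c2.add c1).intervalIntegrable _ _) fun r hr => ?_
          · exact (g2.comp (by fun_prop : Continuous fun x : ℝ => x + T)).abs.add
              (g1.comp (by fun_prop : Continuous fun x : ℝ => x + T)).abs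
          · rw [shd_D1 hv, shd_D2 hv]
            unfold shd Gf
            have a1 := abs_sub (pD2 (vv u) (t + h) (r + T)) (pD2 (vv u) t (r + T))
            have a2 := abs_sub (pD1 (vv u) (t + h) (r + T)) (pD1 (vv u) t (r + T))
            linarith
      _ = (∫ x in r1..r2, Gf u (t + h) (x + T)) + ∫ x in r1..r2, Gf u t (x + T) :=
          intervalIntegral.integral_add (c2.intervalIntegrable _ _) (c1.intervalIntegrable _ _)
      _ ≤ ε := by linarith
  · have hx1 : T1 ≤ x := (le_max_right _ _).trans hx
    have hx2 : 1 ≤ x := (hT0.trans (le_max_left _ _)).trans hx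
    have hx0 : 0 < x := by linarith
    refine le_trans ?_ (hT1 x hx1).le
    have hq : 0 < sqrt x := sqrt_pos.2 hx0
    have hqq : sqrt x ^ 2 = x := sq_sqrt hx0.le
    rw [div_le_div_iff₀ hx0 hq]
    have := W_bound hC hb h t x hx2
    calc |shd (vv u) h t x| * sqrt x ≤ 4 * C * sqrt x * sqrt x := by gcongr
      _ = 4 * C * x := by rw [mul_assoc, ← sq, hqq]

theorem rpow_win {S r : ℝ} (hS : 1 ≤ S) (hr : S ^ 2 ≤ r) : r ^ (-(3/2) : ℝ) ≤ 1 / S ^ 3 := by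
  have h1 : (1:ℝ) ≤ S ^ 2 := one_le_pow₀ hS
  have h2 : r ^ (-(3/2) : ℝ) ≤ (S ^ 2) ^ (-(3/2) : ℝ) :=
    rpow_le_rpow_of_nonpos (by linarith) hr (by norm_num)
  refine h2.trans (le_of_eq ?_)
  rw [rpow_m32 h1, sqrt_sq (by linarith)]
  have : 0 < S := by linarith
  field_simp

theorem mom_D11_small {Q : ℝ → ℝ} {u : ℝ → ℝ → ℝ} (hu : SolvesReduced Q u)
    {C : ℝ} (hC : 0 ≤ C)
    (hb : ∀ t r, 1 ≤ r → |u t r| ≤ C * r ^ (-(3/2) : ℝ)) {S : ℝ} (hS : 1 ≤ S) (t : ℝ) :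
    |mom (pD1 (pD1 (vv u))) (S ^ 2) t| ≤ 17 * C * S ^ 3 := by
  have h : PC 2 u := hu.1
  have hv := vv_PC h
  have hS0 : 0 < S := by linarith
  set R := S ^ 2 with hR
  have hR1 : 1 ≤ R := one_le_pow₀ hS
  have hR0 : 0 ≤ R := by linarith
  have hc2 : Continuous (fun r => pD2 (pD2 (vv u)) t r) :=
    (pD2_cont (pD2_C hv)).comp (Continuous.prodMk_right t)
  have hc1 : Continuous (fun r => pD1 (pD1 (vv u)) t r) :=
    (pD1_cont (pD1_C hv)).comp (Continuous.prodMk_right t)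
  have k1 : |∫ r in R..(2 * R), (r - R) * (2 * R - r) * pD2 (pD2 (vv u)) t r|
      ≤ 4 * R * (4 * C * S) := by
    refine phi_parts (y := fun r => vv u t r)
      (y' := fun r => pD2 (vv u) t r) (fun r => ?_) (fun r => ?_) (by fun_prop) hR0
      fun r h1 h2 => ?_
    · exact (pD2_hasDerivAt hv.one t r)
    · exact (pD2_hasDerivAt (pD2_C hv) t r)
    · have hr1 : 1 ≤ r := by linarith
      unfold vv
      rw [abs_mul, abs_of_pos (by positivity : (0:ℝ) < r ^ 2 + 1)]
      calc (r ^ 2 + 1) * |u t r| ≤ (r ^ 2 + 1) * (C * r ^ (-(3/2) : ℝ)) := by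
            gcongr; exact hb t r hr1
        _ = C * ((r ^ 2 + 1) * r ^ (-(3/2) : ℝ)) := by ring
        _ ≤ C * (2 * sqrt r) := mul_le_mul_of_nonneg_left (rpow_m32_le hr1) hC
        _ ≤ C * (2 * (2 * S)) := by gcongr; exact sqrt_win hS h2
        _ = _ := by ring
  have k2 : |∫ r in R..(2 * R), (r - R) * (2 * R - r) *
      (pD1 (pD1 (vv u)) t r - pD2 (pD2 (vv u)) t r)| ≤ (3 * (C * (1 / S ^ 3))) * R ^ 3 / 6 := by
    refine phi_bound (by fun_prop) hR0 fun r h1 h2 => ?_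
    have hr1 : 1 ≤ r := by linarith
    refine (vv_src2 hu t r).trans ?_
    have := (hb t r hr1).trans (mul_le_mul_of_nonneg_left (rpow_win hS h1) hC)
    linarith
  have k3 : mom (pD1 (pD1 (vv u))) R t
      = (∫ r in R..(2 * R), (r - R) * (2 * R - r) * pD2 (pD2 (vv u)) t r)
        + (∫ r in R..(2 * R), (r - R) * (2 * R - r) *
      (pD1 (pD1 (vv u)) t r - pD2 (pD2 (vv u)) t r)) := by
    unfold mom
    rw [← intervalIntegral.integral_add]
    · congr 1; funext r; ring
    all_goals exact Continuous.intervalIntegrable (by fun_prop) _ _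
  rw [k3]
  have e4 : (3 * (C * (1 / S ^ 3))) * R ^ 3 / 6 = C * S ^ 3 / 2 := by
    rw [hR]; field_simp; ring
  rw [e4] at k2
  have e5 : 4 * R * (4 * C * S) = 16 * C * S ^ 3 := by rw [hR]; ring
  rw [e5] at k1
  have e6 : 0 ≤ C * S ^ 3 := by positivity
  refine (abs_add_le _ _).trans ?_
  linarith

theorem mom_shd {F : ℝ → ℝ → ℝ} (hF : PC 1 F) (h R t : ℝ) :
    mom (shd F h) R t = mom F R (t + h) - mom F R t := by
  have c : ∀ t, Continuous (fun r => F t r) := fun t => hF.cont.comp (Continuous.prodMk_right t)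
  have c1 := c t
  have c2 := c (t + h)
  unfold mom shd
  rw [← intervalIntegral.integral_sub]
  · congr 1; funext r; ring
  all_goals exact Continuous.intervalIntegrable (by fun_prop) _ _

theorem second_diff {m m' m'' : ℝ → ℝ} (h1 : ∀ t, HasDerivAt m (m' t) t)
    (h2 : ∀ t, HasDerivAt m' (m'' t) t) {K : ℝ} (hK : ∀ t, |m'' t| ≤ K) (h t : ℝ) :
    |(m (t + h) - m t) - (m t - m (t - h))| ≤ K * h ^ 2 := by
  have k1 : ∀ s, |m' (s + h) - m' s| ≤ K * |h| := by
    intro s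
    have := convex_univ.norm_image_sub_le_of_norm_hasDerivWithin_le (f := m') (f' := m'')
      (fun x _ => (h2 x).hasDerivWithinAt) (fun x _ => hK x) (Set.mem_univ s) (Set.mem_univ (s + h))
    simpa using this
  have k2 := convex_univ.norm_image_sub_le_of_norm_hasDerivWithin_le
    (f := fun s => m (s + h) - m s) (f' := fun s => m' (s + h) - m' s) (C := K * |h|)
    (fun x _ => (((h1 (x + h)).comp_add_const x h).sub (h1 x)).hasDerivWithinAt)
    (fun x _ => k1 x) (Set.mem_univ (t - h)) (Set.mem_univ t)
  simp only [Real.norm_eq_abs, sub_add_cancel, sub_sub_cancel] at k2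
  rwa [mul_assoc, ← sq, sq_abs] at k2

theorem l_per {Q : ℝ → ℝ} {u : ℝ → ℝ → ℝ} (hu : SolvesReduced Q u)
    {C C4 R : ℝ} (hC : 0 ≤ C) (hC4 : 0 ≤ C4) (h : ℝ) {l : ℝ → ℝ}
    (hb : ∀ t r, 1 ≤ r → |u t r| ≤ C * r ^ (-(3/2) : ℝ))
    (hl : ∀ t r, R ≤ r → |r * shd (vv u) h t r - l t| ≤ C4 * r ^ (-(1/2) : ℝ)) (t : ℝ) :
    l t = l (t - h) := by
  have hP : PC 2 u := hu.1
  have hv := vv_PC hP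
  by_contra hne
  set lam := l t - l (t - h) with hlam
  have hlp : 0 < |lam| := abs_pos.2 (sub_ne_zero.2 hne)
  have main : ∀ S, 1 ≤ S → R ≤ S → |lam| * S / 12 ≤ 17 * C * h ^ 2 + C4 := by
    intro S hS hRS
    have hS0 : 0 < S := by linarith
    set P := S ^ 2 with hPd
    have hP0 : 0 < P := by positivity
    have hP1 : 1 ≤ P := one_le_pow₀ hS
    have hPR : R ≤ P := by nlinarith
    have sd := second_diff (m := fun t => mom (vv u) P t) (fun t => mom_deriv hv.one P t)
      (fun t => mom_deriv (pD1_C hv) P t) (fun t => mom_D11_small hu hC hb hS t) h t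
    have e1 := mom_shd hv.one h P t
    have e2 := mom_shd hv.one h P (t - h)
    rw [sub_add_cancel] at e2
    rw [← e1, ← e2] at sd
    have c : ∀ t, Continuous (fun r => shd (vv u) h t r) :=
      fun t => (shd_PC hv.one h).cont.comp (Continuous.prodMk_right t)
    have c1 := c t
    have c2 := c (t - h)
    have e3 : lam * (mom (shd (vv u) h) P t - mom (shd (vv u) h) P (t - h))
        = ∫ r in P..(2 * P), (r - P) * (2 * P - r) *
          (lam * (shd (vv u) h t r - shd (vv u) h (t - h) r)) := by
      unfold mom
      rw [← intervalIntegral.integral_sub, ← intervalIntegral.integral_const_mul]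
      · congr 1; funext r; ring
      all_goals exact Continuous.intervalIntegrable (by fun_prop) _ _
    have e4 : (lam ^ 2 / (2 * P) - |lam| * (2 * C4 * (1 / S ^ 3))) * (P ^ 3 / 6)
        ≤ ∫ r in P..(2 * P), (r - P) * (2 * P - r) *
          (lam * (shd (vv u) h t r - shd (vv u) h (t - h) r)) := by
      rw [← phi_int, ← intervalIntegral.integral_const_mul]
      refine intervalIntegral.integral_mono_on (by linarith)
        (Continuous.intervalIntegrable (by fun_prop) _ _)
        (Continuous.intervalIntegrable (by fun_prop) _ _) fun r hr => ?_
      have hr1 : 1 ≤ r := by linarith [hr.1]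
      have hr0 : 0 < r := by linarith
      have hp : 0 ≤ (r - P) * (2 * P - r) :=
        mul_nonneg (by linarith [hr.1]) (by linarith [hr.2])
      have a1 := hl t r (by linarith [hr.1])
      have a2 := hl (t - h) r (by linarith [hr.1])
      set y := shd (vv u) h t r - shd (vv u) h (t - h) r with hy
      have a3 : |r * y - lam| ≤ 2 * C4 * r ^ (-(1/2) : ℝ) := by
        have : r * y - lam = (r * shd (vv u) h t r - l t) - (r * shd (vv u) h (t - h) r - l (t - h)) := by
          rw [hy, hlam]; ring
        rw [this]
        refine (abs_sub _ _).trans ?_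
        linarith
      have a4 : |y - lam / r| ≤ 2 * C4 * (1 / S ^ 3) := by
        have b1 : y - lam / r = (r * y - lam) / r := by field_simp
        rw [b1, abs_div, abs_of_pos hr0]
        have b2 : r ^ (-(3/2) : ℝ) = r ^ (-(1/2) : ℝ) / r := by
          rw [← rpow_sub_one hr0.ne']; norm_num
        calc |r * y - lam| / r ≤ 2 * C4 * r ^ (-(1/2) : ℝ) / r := by gcongr
          _ = 2 * C4 * r ^ (-(3/2) : ℝ) := by rw [b2]; ring
          _ ≤ _ := mul_le_mul_of_nonneg_left (rpow_win hS hr.1) (by positivity)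
      have a5 : lam ^ 2 / (2 * P) - |lam| * (2 * C4 * (1 / S ^ 3)) ≤ lam * y := by
        have b1 : lam * y = lam ^ 2 / r + lam * (y - lam / r) := by field_simp; ring
        have b2 : lam ^ 2 / (2 * P) ≤ lam ^ 2 / r :=
          div_le_div_of_nonneg_left (sq_nonneg _) hr0 hr.2
        have b3 : -(|lam| * (2 * C4 * (1 / S ^ 3))) ≤ lam * (y - lam / r) := by
          have : |lam * (y - lam / r)| ≤ |lam| * (2 * C4 * (1 / S ^ 3)) := by
            rw [abs_mul]; gcongr
          exact (abs_le.1 this).1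
        linarith
      rw [mul_comm]
      exact mul_le_mul_of_nonneg_left a5 hp
    rw [← e3] at e4
    have e5 : lam * (mom (shd (vv u) h) P t - mom (shd (vv u) h) P (t - h))
        ≤ |lam| * (17 * C * S ^ 3 * h ^ 2) := by
      refine (le_abs_self _).trans ?_
      rw [abs_mul]; gcongr
    have e6 : (lam ^ 2 / (2 * P) - |lam| * (2 * C4 * (1 / S ^ 3))) * (P ^ 3 / 6)
        = |lam| * S ^ 3 * (|lam| * S / 12 - C4 / 3) := by
      rw [← sq_abs lam, hPd]; field_simp; ring
    rw [e6] at e4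
    have e7 : |lam| * S ^ 3 * (|lam| * S / 12 - C4 / 3) ≤ |lam| * S ^ 3 * (17 * C * h ^ 2) := by
      refine (e4.trans e5).trans (le_of_eq ?_); ring
    have e8 := le_of_mul_le_mul_left e7 (by positivity)
    linarith
  set A := 17 * C * h ^ 2 + C4 with hA
  have hA0 : 0 ≤ A := by positivity
  have hm := main (1 + |R| + 12 * A / |lam|) (by
    have : 0 ≤ 12 * A / |lam| := by positivity
    linarith [abs_nonneg R]) (by
    have : 0 ≤ 12 * A / |lam| := by positivity
    linarith [le_abs_self R])
  have : |lam| * (1 + |R| + 12 * A / |lam|) / 12 = |lam| * (1 + |R|) / 12 + A := by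
    field_simp
  rw [this] at hm
  have : 0 < |lam| * (1 + |R|) := by positivity
  linarith

theorem u_static {Q : ℝ → ℝ} {u : ℝ → ℝ → ℝ} (n : ℕ) (hQ : IsHarmonicMapSol Q)
    (hQt : Tendsto Q atTop (nhds ((n : ℝ) * Real.pi)))
    (hu : SolvesReduced Q u)
    (hfin : FiniteEnergyReduced u) (hcomp : TotallyBoundedTraj u) (h t r : ℝ) :
    u (t + h) r = u t r := by
  have hP : PC 2 u := hu.1
  have hv := vv_PC hP
  obtain ⟨B, hB0, hB⟩ := en_bdd hP.one hfin hcomp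
  have htail := en_tail hP.one hfin hcomp
  obtain ⟨C, c, hC, hlim⟩ := u_limit hP.one B hB0 hB
  have hb : ∀ t r, 1 ≤ r → |u t r| ≤ C * r ^ (-(3/2) : ℝ) := by
    intro t r hr
    have := hlim t r hr
    rwa [c_zero hu hB hC hlim t, sub_zero] at this
  obtain ⟨K, RQ, hK, hRQ, hQd⟩ := Q_decay hQ n hQt
  set C0 := 3 + (2 * K + 4 * C) ^ 2 with hC0
  have hC00 : 0 ≤ C0 := by positivity
  set R := max RQ (2 * C0) with hR
  have hR1 : 1 ≤ R := hRQ.trans (le_max_left _ _)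
  have hforc : ∀ h t r, R ≤ r →
      |forc (shd (vv u) h) t r| ≤ C0 * |shd (vv u) h t r| * r ^ (-3 : ℝ) :=
    fun h t r hr => W_forc hu n hC hK hRQ hQd hb h t r ((le_max_left _ _).trans hr)
  have hWb : ∀ h t r, R ≤ r → |shd (vv u) h t r| ≤ 4 * C * r ^ (1/2 : ℝ) := by
    intro h t r hr
    rw [← sqrt_eq_rpow]
    exact W_bound hC hb h t r (hR1.trans hr)
  have hWt : ∀ h, TailHyp (shd (vv u) h) := fun h => W_tail hP hC hb htail h
  obtain ⟨C4, hC4, hex⟩ := limit_exists (4 * C) C0 R hR1 (by positivity) hC00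
  have hex' := fun h => hex (shd (vv u) h) (shd_PC hv h) (hforc h) (hWb h) (hWt h)
  choose l hl1 hl2 using hex'
  have hz : Tendsto (fun a : ℝ => C4 * a ^ (-(1/2) : ℝ)) atTop (nhds 0) := by
    simpa using (tendsto_rpow_neg_atTop (by norm_num : (0:ℝ) < 1/2)).const_mul C4
  have hlt : ∀ h t, Tendsto (fun r => r * shd (vv u) h t r) atTop (nhds (l h t)) := by
    intro h t
    rw [tendsto_iff_norm_sub_tendsto_zero]
    refine squeeze_zero' (Eventually.of_forall fun _ => norm_nonneg _) ?_ hz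
    filter_upwards [eventually_ge_atTop R] with r hr using hl2 h t r hr
  have hper : ∀ h t, l h t = l h (t - h) := fun h t => l_per hu hC hC4 h hb (hl2 h) t
  have hper2 : ∀ h t (j : ℕ), l h (t + j * h) = l h t := by
    intro h t j
    induction j with
    | zero => simp
    | succ j ih =>
      rw [hper h, ← ih]
      congr 1
      push_cast; ring
  have hmul : ∀ h t (k : ℕ), Tendsto (fun r => r * shd (vv u) (k * h) t r) atTop (nhds (k * l h t)) := by
    intro h t k
    induction k with
    | zero => simp [shd]
    | succ k ih =>
      have h2 := hlt h (t + k * h)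
      rw [hper2] at h2
      have h3 := ih.add h2
      have e : ((k + 1 : ℕ) : ℝ) * l h t = k * l h t + l h t := by push_cast; ring
      rw [e]
      refine h3.congr fun r => ?_
      unfold shd
      rw [show t + ((k + 1 : ℕ) : ℝ) * h = t + k * h + h by push_cast; ring]
      ring
  have hl0 : ∀ h t, l h t = 0 := by
    intro h t
    by_contra hne
    have hp : 0 < |l h t| := abs_pos.2 hne
    obtain ⟨k, hk⟩ := exists_nat_gt (C4 / |l h t|)
    have e1 := tendsto_nhds_unique (hmul h t k) (hlt (k * h) t)
    have e2 := hl1 (k * h) t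
    rw [← e1, abs_mul, Nat.abs_cast] at e2
    rw [div_lt_iff₀ hp] at hk
    linarith
  have hW1 : ∀ t r, R ≤ r → shd (vv u) h t r = 0 := by
    refine contraction (shd_PC hv h) (M := C4) hR1 hC00 hC4 (le_max_right _ _) (hforc h) ?_ ?_ (hWt h)
    · intro t r hr
      have hr1 : 1 ≤ r := hR1.trans hr
      have hr0 : 0 < r := by linarith
      have e1 := hl2 h t r hr
      rw [hl0, sub_zero, abs_mul, abs_of_pos hr0] at e1
      have e2 : r ^ (-(1/2) : ℝ) ≤ 1 := rpow_le_one_of_one_le_of_nonpos hr1 (by norm_num)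
      rw [rpow_neg_one, ← div_eq_mul_inv, le_div_iff₀ hr0]
      nlinarith
    · intro t
      have := hlt h t
      rwa [hl0] at this
  have hW : ∀ t r, shd (vv u) h t r = 0 := by
    refine lateral_unique (shd_PC hv h) (R := R) (S := 2 * (B / 2 + 2 + C)) (W_src hu h)
      (fun t r hr => hW1 t r hr.le) fun t r => ?_
    have hbd : ∀ t, |u t r| ≤ B / 2 + 2 + C := by
      intro t
      have a1 := u_osc hP.one B hB t 1 r
      have a2 := hb t 1 le_rfl
      rw [one_rpow, mul_one] at a2
      have := abs_add_le (u t r - u t 1) (u t 1)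
      rw [sub_add_cancel] at this
      linarith
    rw [W_vv, abs_mul, abs_of_pos (by positivity : (0:ℝ) < r ^ 2 + 1), mul_comm]
    gcongr
    unfold shd
    have := abs_sub (u (t + h) r) (u t r)
    linarith [hbd t, hbd (t + h)]
  have := hW t r
  rw [W_vv] at this
  have hw : (r ^ 2 + 1 : ℝ) ≠ 0 := by positivity
  have h0 := (mul_eq_zero.1 this).resolve_left hw
  unfold shd at h0
  linarith

theorem stmt17 (n : ℕ) (Q : ℝ → ℝ) (hQ : IsHarmonicMapSol Q)
    (hQb : Tendsto Q atBot (nhds 0))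
    (hQt : Tendsto Q atTop (nhds ((n : ℝ) * Real.pi)))
    (u : ℝ → ℝ → ℝ) (hu : SolvesReduced Q u)
    (hfin : FiniteEnergyReduced u) (hcomp : TotallyBoundedTraj u) :
    ∃ U : ℝ → ℝ, ContDiff ℝ 2 U ∧
      Integrable (fun r : ℝ => (deriv U r) ^ 2 * (r ^ 2 + 1) ^ 2) ∧
      (∀ r : ℝ, -(deriv (deriv U) r) - (4 * r / (r ^ 2 + 1)) * deriv U r
        + Vpot Q r * U r = Npot Q r (U r)) ∧
      ∀ t r : ℝ, u t r = U r ∧ deriv (fun s => u s r) t = 0 := by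
  have hs : ∀ t r, u t r = u 0 r := by
    intro t r
    have := u_static n hQ hQt hu hfin hcomp t 0 r
    rwa [zero_add] at this
  have hc : ∀ r, (fun s => u s r) = fun _ => u 0 r := fun r => funext fun s => hs s r
  have hd : ∀ t r, deriv (fun s => u s r) t = 0 := by
    intro t r; rw [hc r]; simp
  refine ⟨u 0, ?_, ?_, ?_, fun t r => ⟨hs t r, hd t r⟩⟩
  · have h1 : ContDiff ℝ 2 (fun r : ℝ => ((0 : ℝ), r)) := by fun_prop
    exact hu.1.comp h1
  · have := hfin 0
    refine this.congr (Eventually.of_forall fun r => ?_)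
    simp only [hd]
    ring
  · intro r
    have e := hu.2 0 r
    have h2 : deriv (deriv (fun s => u s r)) 0 = 0 := by
      rw [hc r]; simp
    rw [h2] at e
    linarith
end
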